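/- Let p and q be prime numbers with p ≡ 5 (mod 8), q ≡ 3 (mod 8), and Legendre symbol (p/q) = −1. Then the class number of the multiquadratic field ℚ(√2, √p, √q) is odd (equivalently, its 2-class number is 1). -/

import Mathlib

namespace QuadraticGenus

section ConjugateIdeals

open Ideal UniqueFactorizationMonoid

variable {A B : Type*} [CommRing A] [IsDedekindDomain A]
  [CommRing B] [IsDedekindDomain B] [Algebra A B]

omit [IsDedekindDomain A] [IsDedekindDomain B] in
theorem map_conj_map_conj (σ : B ≃ₐ[A] B) (hσ : ∀ x, σ (σ x) = x) (I : Ideal B) :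
    (I.map σ).map σ = I := by
  change (I.map (σ : B →+* B)).map (σ : B →+* B) = I
  rw [Ideal.map_map]
  convert Ideal.map_id I
  ext x; exact hσ x

omit [IsDedekindDomain A] in
/-- The product of an ideal with its conjugate under an involution is extended from the fixed
ring. -/
theorem exists_map_eq_mul_conj (σ : B ≃ₐ[A] B) (hσ : ∀ x, σ (σ x) = x)
    (hfix : ∀ x, σ x = x → ∃ a, algebraMap A B a = x) (I : Ideal B) :
    ∃ J : Ideal A, I * I.map σ = J.map (algebraMap A B) := by
  let J : Ideal A := (I * I.map σ).comap (algebraMap A B)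
  refine ⟨J, le_antisymm ?_ Ideal.map_comap_le⟩
  by_cases hI : I = ⊥
  · simp [hI]
  have hmem : ∀ x ∈ I, ∀ y ∈ I, x * σ y ∈ I * I.map σ := fun x hx y hy =>
    Ideal.mul_mem_mul hx (Ideal.mem_map_of_mem σ hy)
  have hmap : I.map σ = Ideal.comap σ.symm I := by
    exact Ideal.map_comap_of_equiv (I := I) (σ : B ≃+* B)
  have key : ∀ x ∈ I, ∀ y ∈ I, x * σ y ∈ J.map (algebraMap A B) := by
    intro x hx y hy
    obtain ⟨t, ht⟩ := hfix (x * σ y + y * σ x) (by simp only [map_add, map_mul, hσ]; ring)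
    obtain ⟨m, hm⟩ := hfix (x * σ x) (by simp only [map_mul, hσ]; ring)
    obtain ⟨n, hn⟩ := hfix (y * σ y) (by simp only [map_mul, hσ]; ring)
    have htJ : t ∈ J := by
      refine Ideal.mem_comap.mpr ?_
      rw [ht]; exact add_mem (hmem x hx y hy) (hmem y hy x hx)
    have hmJ : m ∈ J := by
      refine Ideal.mem_comap.mpr ?_
      rw [hm]; exact hmem x hx x hx
    have hnJ : n ∈ J := by
      refine Ideal.mem_comap.mpr ?_
      rw [hn]; exact hmem y hy y hy
    set z := x * σ y with hz
    set E := J.map (algebraMap A B) with hE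
    by_cases hE0 : E = ⊥
    · have h1 : m = 0 ∨ algebraMap A B m = 0 := by
        right
        have : algebraMap A B m ∈ E := Ideal.mem_map_of_mem _ hmJ
        simpa [hE0] using this
      have h2 : x * σ x = 0 := by
        rw [← hm]; rcases h1 with h | h <;> simp [h]
      have hx0 : x = 0 := by
        rcases mul_eq_zero.mp h2 with h | h
        · exact h
        · simpa using h
      simp [hz, hx0]
    have hzz : z * z = algebraMap A B t * z - algebraMap A B m * algebraMap A B n := by
      rw [ht, hm, hn, hz]; ring
    let H := Ideal.span {z} ⊔ E
    have hH : H * H ≤ E * H := by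
      have h1 : Ideal.span {z} * Ideal.span {z} ≤ E * H := by
        rw [Ideal.span_singleton_mul_span_singleton, Ideal.span_singleton_le_iff_mem, hzz]
        refine sub_mem (Ideal.mul_mem_mul (Ideal.mem_map_of_mem _ htJ) ?_)
          (Ideal.mul_mem_mul (Ideal.mem_map_of_mem _ hmJ) ?_)
        · exact Ideal.mem_sup_left (Ideal.mem_span_singleton_self z)
        · exact Ideal.mem_sup_right (Ideal.mem_map_of_mem _ hnJ)
      change (Ideal.span {z} ⊔ E) * H ≤ E * H
      rw [Ideal.sup_mul]
      refine sup_le ?_ le_rfl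
      change Ideal.span {z} * (Ideal.span {z} ⊔ E) ≤ _
      rw [Ideal.mul_sup]
      refine sup_le h1 ?_
      rw [mul_comm]
      exact Ideal.mul_mono_right le_sup_left
    have hH0 : H ≠ ⊥ := fun h => hE0 (le_bot_iff.mp (h ▸ le_sup_right))
    have : H ≤ E := by
      have h2 : E * H ∣ H * H := Ideal.dvd_iff_le.mpr hH
      exact Ideal.dvd_iff_le.mp ((mul_dvd_mul_iff_right hH0).mp h2)
    exact this (Ideal.mem_sup_left (Ideal.mem_span_singleton_self z))
  refine Ideal.mul_le.mpr fun x hx y hy => ?_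
  rw [hmap] at hy
  have := key x hx (σ.symm y) hy
  simpa using this

omit [IsDedekindDomain A] in
/-- An invariant ideal that is not bad at any invariant prime outside `T` and has even exponents
at `T` is extended from the fixed ring. -/
theorem exists_map_eq_of_even_count (σ : B ≃ₐ[A] B) (hσ : ∀ x, σ (σ x) = x)
    (hfix : ∀ x, σ x = x → ∃ a, algebraMap A B a = x) (T : Set (Ideal B))
    (hT : ∀ P : Ideal B, P.IsPrime → P ≠ ⊥ → P.map σ = P → P ∉ T →
      ∃ J : Ideal A, P = J.map (algebraMap A B))
    (hTinv : ∀ P ∈ T, P.map σ = P) [DecidableEq (Ideal B)] (I : Ideal B) (hI : I ≠ ⊥)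
    (hinv : I.map σ = I) (heven : ∀ P ∈ T, Even ((normalizedFactors I).count P)) :
    ∃ J : Ideal A, I = J.map (algebraMap A B) := by
  have hmm : ∀ I : Ideal B, (I.map σ).map σ = I := map_conj_map_conj σ hσ
  have hmbot : ∀ I : Ideal B, I ≠ ⊥ → I.map σ ≠ ⊥ := by
    intro I h h'
    apply h
    rw [← hmm I, h', Ideal.map_bot]
  have step : ∀ n : ℕ, ∀ I : Ideal B, (normalizedFactors I).card = n → I ≠ ⊥ → I.map σ = I →
      (∀ P ∈ T, Even ((normalizedFactors I).count P)) →
      ∃ J : Ideal A, I = J.map (algebraMap A B) := by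
    intro n
    induction n using Nat.strong_induction_on with
    | _ n ih =>
    intro I hn hI hinv heven
    have hdiv : ∀ Q I' : Ideal B, Q ≠ ⊤ → I = Q * I' → Q.map σ = Q →
        (∃ J : Ideal A, Q = J.map (algebraMap A B)) →
        (∀ P ∈ T, Even ((normalizedFactors Q).count P)) →
        ∃ J : Ideal A, I = J.map (algebraMap A B) := by
      intro Q I' hQ1 hQI hQinv hQ hQev
      have hQ0 : Q ≠ ⊥ := by rintro rfl; simp at hQI; exact hI hQI
      have hI'0 : I' ≠ ⊥ := by rintro rfl; simp at hQI; exact hI hQI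
      have hnf : normalizedFactors I = normalizedFactors Q + normalizedFactors I' := by
        rw [hQI]; exact normalizedFactors_mul hQ0 hI'0
      have hQpos : 0 < (normalizedFactors Q).card := by
        rw [Multiset.card_pos]
        intro h
        rw [normalizedFactors_eq_zero_iff hQ0, Ideal.isUnit_iff] at h
        exact hQ1 h
      obtain ⟨J', hJ'⟩ := ih (normalizedFactors I').card
        (by rw [← hn, hnf, Multiset.card_add]; omega) I' rfl hI'0
        (by
          have h := hinv
          rw [hQI, Ideal.map_mul, hQinv] at h
          exact mul_left_cancel₀ hQ0 h)
        (fun P hP => by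
          have h := heven P hP
          rw [hnf, Multiset.count_add] at h
          exact (Nat.even_add.mp h).mp (hQev P hP))
      obtain ⟨J, hJ⟩ := hQ
      exact ⟨J * J', by rw [hQI, Ideal.map_mul, hJ, hJ']⟩
    by_cases hI1 : I = ⊤
    · exact ⟨⊤, by rw [hI1, Ideal.map_top]⟩
    obtain ⟨P, hPmax, hIP⟩ := Ideal.exists_le_maximal I hI1
    have hPp : P.IsPrime := hPmax.isPrime
    have hP0 : P ≠ ⊥ := fun h => hI (le_bot_iff.mp (h ▸ hIP))
    have hPirr : Irreducible P := ((Ideal.prime_iff_isPrime hP0).mpr hPp).irreducible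
    have hnfP : normalizedFactors P = {P} := by
      rw [normalizedFactors_irreducible hPirr, normalize_eq]
    obtain ⟨I₁, hI₁⟩ := Ideal.dvd_iff_le.mpr hIP
    by_cases hPinv : P.map σ = P
    · by_cases hPT : P ∈ T
      · have h2 : P * P ∣ I := by
          have hev := heven P hPT
          have hI₁0 : I₁ ≠ ⊥ := by rintro rfl; simp at hI₁; exact hI hI₁
          have hnf : normalizedFactors I = normalizedFactors P + normalizedFactors I₁ := by
            rw [hI₁]; exact normalizedFactors_mul hP0 hI₁0
          rw [hnf, hnfP, Multiset.count_add, Multiset.count_singleton_self] at hev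
          have hpos : 0 < (normalizedFactors I₁).count P := by
            by_contra h
            have : (normalizedFactors I₁).count P = 0 := by omega
            rw [this] at hev
            exact absurd hev (by decide)
          rw [hI₁]
          exact mul_dvd_mul_left P (dvd_of_mem_normalizedFactors (Multiset.count_pos.mp hpos))
        obtain ⟨I', hI'⟩ := h2
        refine hdiv (P * P) I'
          (fun h => hPmax.ne_top (top_le_iff.mp (h.ge.trans Ideal.mul_le_left)))
          hI' (by rw [Ideal.map_mul, hPinv]) ?_ ?_
        · obtain ⟨J, hJ⟩ := exists_map_eq_mul_conj σ hσ hfix P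
          exact ⟨J, by rw [← hJ, hPinv]⟩
        · intro Q _
          rw [normalizedFactors_mul hP0 hP0, Multiset.count_add]
          exact Even.add_self _
      · refine hdiv P I₁ hPmax.ne_top hI₁ hPinv (hT P hPp hP0 hPinv hPT) ?_
        intro Q hQ
        rw [hnfP, Multiset.count_singleton, if_neg (by rintro rfl; exact hPT hQ)]
        exact Even.zero
    · have hσP0 := hmbot P hP0
      have hσPp : (P.map σ).IsPrime := Ideal.map_isPrime_of_equiv (σ : B ≃+* B)
      have hσPirr : Irreducible (P.map σ) :=
        ((Ideal.prime_iff_isPrime hσP0).mpr hσPp).irreducible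
      have hnfσP : normalizedFactors (P.map σ) = {P.map σ} := by
        rw [normalizedFactors_irreducible hσPirr, normalize_eq]
      have h2 : P * P.map σ ∣ I := by
        have hd : P.map σ ∣ P * I₁ := by
          rw [← hI₁]
          exact Ideal.dvd_iff_le.mpr (hinv ▸ Ideal.map_mono hIP)
        rcases ((Ideal.prime_iff_isPrime hσP0).mpr hσPp).dvd_or_dvd hd with h | h
        · exfalso
          have hle := Ideal.dvd_iff_le.mp h
          exact hPinv ((hPmax.eq_of_le hσPp.ne_top hle).symm)
        · rw [hI₁]; exact mul_dvd_mul_left P h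
      obtain ⟨I', hI'⟩ := h2
      refine hdiv (P * P.map σ) I'
        (fun h => hPmax.ne_top (top_le_iff.mp (h.ge.trans Ideal.mul_le_left)))
        hI' (by rw [Ideal.map_mul, hmm, mul_comm]) (exists_map_eq_mul_conj σ hσ hfix P) ?_
      intro Q hQ
      rw [normalizedFactors_mul hP0 hσP0, Multiset.count_add, hnfP, hnfσP,
        Multiset.count_singleton, Multiset.count_singleton, if_neg, if_neg]
      · exact Even.zero
      · rintro rfl
        have := hTinv _ hQ
        rw [hmm] at this
        exact hPinv this.symm
      · rintro rfl
        exact hPinv (hTinv _ hQ)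
  exact step _ I rfl hI hinv heven

theorem isPrincipal_of_isPrincipal_map [Algebra.IsIntegral A B] [FaithfulSMul A B]
    (σ : B ≃ₐ[A] B) (hσ : ∀ x, σ (σ x) = x)
    (hfix : ∀ x, σ x = x → ∃ a, algebraMap A B a = x)
    (hA : ∀ J : Ideal A, (J ^ 2).IsPrincipal → J.IsPrincipal) (J : Ideal A)
    (hJ : (J.map (algebraMap A B)).IsPrincipal) : J.IsPrincipal := by
  have hinj : Function.Injective (algebraMap A B) := FaithfulSMul.algebraMap_injective A B
  apply hA
  obtain ⟨y, hy⟩ := hJ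
  rw [Ideal.submodule_span_eq] at hy
  by_cases hy0 : y = 0
  · have : J = ⊥ := by
      rw [← Ideal.map_eq_bot_iff_of_injective hinj, hy, hy0]; simp
    rw [this]
    exact ⟨0, by simp⟩
  obtain ⟨n, hn⟩ := hfix (y * σ y) (by simp only [map_mul, hσ]; ring)
  have hJσ : (J.map (algebraMap A B)).map σ = J.map (algebraMap A B) := by
    change (J.map (algebraMap A B)).map (σ : B →+* B) = _
    rw [Ideal.map_map]
    congr 1
    ext a; exact σ.commutes a
  have h2 : (J ^ 2).map (algebraMap A B) = (Ideal.span {n}).map (algebraMap A B) := by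
    rw [Ideal.map_span, Set.image_singleton, hn, ← Ideal.span_singleton_mul_span_singleton,
      Ideal.map_pow, pow_two]
    nth_rw 2 [← hJσ]
    rw [hy, Ideal.map_span, Set.image_singleton]
  have hn0 : n ≠ 0 := by
    rintro rfl
    rw [map_zero] at hn
    rcases mul_eq_zero.mp hn.symm with h | h
    · exact hy0 h
    · exact hy0 (by simpa using h)
  have hle : J ^ 2 ≤ Ideal.span {n} := by
    intro a ha
    have : algebraMap A B a ∈ (Ideal.span {n}).map (algebraMap A B) :=
      h2 ▸ Ideal.mem_map_of_mem _ ha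
    rw [Ideal.map_span, Set.image_singleton, Ideal.mem_span_singleton'] at this
    obtain ⟨b, hb⟩ := this
    have hnB : algebraMap A B n ≠ 0 := (map_ne_zero_iff _ hinj).mpr hn0
    obtain ⟨c, hc⟩ := hfix b (by
      have := congrArg σ hb
      rw [map_mul, σ.commutes, σ.commutes, ← hb] at this
      exact mul_right_cancel₀ hnB this)
    rw [Ideal.mem_span_singleton']
    exact ⟨c, hinj (by rw [map_mul, hc, hb])⟩
  obtain ⟨Q, hQ⟩ := Ideal.dvd_iff_le.mpr hle
  have hQ1 : Q.map (algebraMap A B) = ⊤ := by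
    rw [hQ, Ideal.map_mul] at h2
    have hne : (Ideal.span {n}).map (algebraMap A B) ≠ ⊥ := by
      rw [Ne, Ideal.map_eq_bot_iff_of_injective hinj, Ideal.span_singleton_eq_bot]
      exact hn0
    exact mul_left_cancel₀ hne (h2.trans (Ideal.mul_top _).symm)
  rw [Ideal.map_eq_top_iff _ hinj (Algebra.IsIntegral.isIntegral)] at hQ1
  exact ⟨n, by rw [hQ, hQ1, Ideal.mul_top]⟩

omit [IsDedekindDomain A] [IsDedekindDomain B] in
/-- Hilbert 90 for an involution, denominator free. -/
theorem exists_conj_mul_eq (σ : B ≃ₐ[A] B) (hσ : ∀ x, σ (σ x) = x) {τ : B} (hτ : σ τ = -τ)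
    (hτ0 : τ ≠ 0) (n b : B) (hn : σ n = n) (h : b * σ b = n * n) :
    ∃ z, z ≠ 0 ∧ z * b = n * σ z := by
  by_cases hb : n + σ b = 0
  · refine ⟨τ, hτ0, ?_⟩
    have : b = -n := by
      have h2 : σ (n + σ b) = 0 := by rw [hb, map_zero]
      rw [map_add, hσ, hn] at h2
      exact (neg_eq_of_add_eq_zero_right h2).symm
    rw [this, hτ]; ring
  · refine ⟨n + σ b, hb, ?_⟩
    rw [map_add, hσ, hn]
    linear_combination h

omit [IsDedekindDomain A] in
/-- An invariant prime whose residue field is moved by the involution is unramified and inert. -/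
theorem exists_map_eq_of_conj_sub_notMem [Algebra.IsIntegral A B] (σ : B ≃ₐ[A] B)
    (hσ : ∀ x, σ (σ x) = x)
    (hfix : ∀ x, σ x = x → ∃ a, algebraMap A B a = x) (P : Ideal B) (hP : P.IsPrime)
    (hP0 : P ≠ ⊥) (hinv : P.map σ = P) (θ : B) (hθ : θ - σ θ ∉ P) :
    ∃ J : Ideal A, P = J.map (algebraMap A B) := by
  have hσP : ∀ x ∈ P, σ x ∈ P := fun x hx => hinv ▸ Ideal.mem_map_of_mem σ hx
  have hmax : P.IsMaximal := hP.isMaximal hP0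
  let J : Ideal A := P.comap (algebraMap A B)
  have hJmax : J.IsMaximal := Ideal.isMaximal_comap_of_isIntegral_of_isMaximal P
  refine ⟨J, le_antisymm ?_ Ideal.map_comap_le⟩
  intro x hx
  set E := J.map (algebraMap A B)
  have htr : ∀ y ∈ P, y + σ y ∈ E := by
    intro y hy
    obtain ⟨t, ht⟩ := hfix (y + σ y) (by simp only [map_add, hσ]; ring)
    rw [← ht]
    refine Ideal.mem_map_of_mem _ ?_
    change algebraMap A B t ∈ P
    rw [ht]
    exact add_mem hy (hσP y hy)
  have hδ : (θ - σ θ) * x ∈ E := by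
    have := sub_mem (htr (θ * x) (P.mul_mem_left _ hx)) (E.mul_mem_left (σ θ) (htr x hx))
    convert this using 1
    rw [map_mul]; ring
  obtain ⟨d, hd⟩ := hfix ((θ - σ θ) * (θ - σ θ)) (by simp only [map_mul, map_sub, hσ]; ring)
  have hdJ : d ∉ J := by
    intro h
    have h' : algebraMap A B d ∈ P := h
    rw [hd] at h'
    rcases hP.mem_or_mem h' with h | h <;> exact hθ h
  obtain ⟨a, j, hj, haj⟩ := hJmax.exists_inv hdJ
  have : x = algebraMap A B j * x + algebraMap A B a * (θ - σ θ) * ((θ - σ θ) * x) := by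
    have h1 := congrArg (algebraMap A B) haj
    rw [map_add, map_mul, map_one, hd] at h1
    linear_combination (-x) * h1
  rw [this]
  exact add_mem (E.mul_mem_right _ (Ideal.mem_map_of_mem _ hj)) (E.mul_mem_left _ hδ)

end ConjugateIdeals

section Group

open Ideal UniqueFactorizationMonoid

variable {E : Type*} [CommGroup E] (s : E →* E)

/-- `x ↦ x * s x`. -/
def normHom : E →* E := MonoidHom.id E * s

/-- `x ↦ s x / x`. -/
def diffHom : E →* E := s / MonoidHom.id E

theorem normHom_apply (x : E) : normHom s x = x * s x := rfl

theorem diffHom_apply (x : E) : diffHom s x = s x / x := rfl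

theorem mem_ker_diffHom {x : E} : x ∈ (diffHom s).ker ↔ s x = x := by
  rw [MonoidHom.mem_ker, diffHom_apply, div_eq_one]

theorem mem_ker_normHom {x : E} : x ∈ (normHom s).ker ↔ x * s x = 1 := by
  rw [MonoidHom.mem_ker, normHom_apply]

theorem map_diffHom_ker_normHom :
    (normHom s).ker.map (diffHom s) = (normHom s).ker.map (powMonoidHom 2) := by
  have key : ∀ x ∈ (normHom s).ker, diffHom s x = (x⁻¹) ^ 2 := by
    intro x hx
    rw [mem_ker_normHom] at hx
    rw [diffHom_apply, eq_inv_of_mul_eq_one_right hx, pow_two, div_eq_mul_inv]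
  ext y
  constructor
  · rintro ⟨x, hx, rfl⟩
    exact ⟨x⁻¹, inv_mem hx, (key x hx).symm⟩
  · rintro ⟨x, hx, rfl⟩
    exact ⟨x⁻¹, inv_mem hx, by rw [key _ (inv_mem hx), inv_inv]; rfl⟩

theorem map_normHom_ker_diffHom :
    (diffHom s).ker.map (normHom s) = (diffHom s).ker.map (powMonoidHom 2) := by
  have key : ∀ x ∈ (diffHom s).ker, normHom s x = x ^ 2 := by
    intro x hx
    rw [mem_ker_diffHom] at hx
    rw [normHom_apply, hx, pow_two]
  ext y
  constructor
  · rintro ⟨x, hx, rfl⟩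
    exact ⟨x, hx, (key x hx).symm⟩
  · rintro ⟨x, hx, rfl⟩
    exact ⟨x, hx, key x hx⟩

theorem range_normHom_le (hs : ∀ x, s (s x) = x) : (normHom s).range ≤ (diffHom s).ker := by
  rintro _ ⟨x, rfl⟩
  rw [mem_ker_diffHom, normHom_apply, map_mul, hs, mul_comm]

theorem range_diffHom_le (hs : ∀ x, s (s x) = x) : (diffHom s).range ≤ (normHom s).ker := by
  rintro _ ⟨x, rfl⟩
  rw [mem_ker_normHom, diffHom_apply, map_div, hs]
  simp

/-- The Herbrand quotient of an involution in terms of indices of subgroups of squares. -/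
theorem relIndex_range_normHom_mul (hs : ∀ x, s (s x) = x)
    (h2 : ((diffHom s).ker.map (powMonoidHom 2)).relIndex (diffHom s).ker ≠ 0) (c : ℕ)
    (hc : ((normHom s).ker.map (powMonoidHom 2)).relIndex (normHom s).ker =
      c * ((diffHom s).ker.map (powMonoidHom 2)).relIndex (diffHom s).ker) :
    (diffHom s).range.relIndex (normHom s).ker =
        c * (normHom s).range.relIndex (diffHom s).ker ∧
      (normHom s).range.relIndex (diffHom s).ker ≠ 0 := by
  set U := (diffHom s).ker ⊔ (normHom s).ker with hU
  have hN : ((diffHom s).ker.map (powMonoidHom 2)).relIndex (normHom s).range = U.index := by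
    rw [← map_normHom_ker_diffHom, MonoidHom.range_eq_map, Subgroup.relIndex_map_map,
      top_sup_eq, Subgroup.relIndex_top_right]
  have hM : ((normHom s).ker.map (powMonoidHom 2)).relIndex (diffHom s).range = U.index := by
    rw [← map_diffHom_ker_normHom s, MonoidHom.range_eq_map, Subgroup.relIndex_map_map,
      top_sup_eq, Subgroup.relIndex_top_right, sup_comm]
  have e1 := Subgroup.relIndex_mul_relIndex ((diffHom s).ker.map (powMonoidHom 2))
    (normHom s).range (diffHom s).ker
    (by rw [← map_normHom_ker_diffHom]; exact Subgroup.map_le_range _ _)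
    (range_normHom_le s hs)
  have e2 := Subgroup.relIndex_mul_relIndex ((normHom s).ker.map (powMonoidHom 2))
    (diffHom s).range (normHom s).ker
    (by rw [← map_diffHom_ker_normHom s]; exact Subgroup.map_le_range _ _)
    (range_diffHom_le s hs)
  rw [hN] at e1
  rw [hM, hc, ← e1] at e2
  rw [← e1] at h2
  refine ⟨?_, right_ne_zero_of_mul h2⟩
  apply Nat.eq_of_mul_eq_mul_left (Nat.pos_of_ne_zero (left_ne_zero_of_mul h2))
  rw [e2]; ring

end Group

section Rank

open Ideal UniqueFactorizationMonoid

theorem index_range_zsmul_two_pi (r : ℕ) :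
    (DistribSMul.toAddMonoidHom (Fin r → ℤ) (2 : ℤ)).range.index = 2 ^ r := by
  let f : (Fin r → ℤ) →+ (Fin r → ZMod 2) :=
    AddMonoidHom.compLeft (Int.castAddHom (ZMod 2)) (Fin r)
  have hf : Function.Surjective f := by
    intro g
    refine ⟨fun i => (g i).cast, ?_⟩
    ext i
    simp [f]
  have hker : f.ker = (DistribSMul.toAddMonoidHom (Fin r → ℤ) (2 : ℤ)).range := by
    ext x
    rw [AddMonoidHom.mem_ker, AddMonoidHom.mem_range]
    constructor
    · intro h
      have h' : ∀ i, ((x i : ℤ) : ZMod 2) = 0 := fun i => congrFun h i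
      have h2 : ∀ i, ∃ y, x i = 2 * y := fun i => by
        have := (ZMod.intCast_zmod_eq_zero_iff_dvd (x i) 2).mp (h' i)
        exact_mod_cast this
      choose y hy using h2
      exact ⟨y, by ext i; simp [hy]⟩
    · rintro ⟨y, rfl⟩
      ext i
      have : (2 : ZMod 2) = 0 := rfl
      simp [f, this]
  rw [← hker, AddSubgroup.index_ker, AddMonoidHom.range_eq_top.mpr hf]
  simp

theorem index_range_zsmul_two_of_free (V : Type*) [AddCommGroup V] [Module.Finite ℤ V]
    [Module.Free ℤ V] :
    (DistribSMul.toAddMonoidHom V (2 : ℤ)).range.index = 2 ^ Module.finrank ℤ V := by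
  let e := (Module.finBasis ℤ V).equivFun
  rw [← index_range_zsmul_two_pi]
  have : (DistribSMul.toAddMonoidHom (Fin (Module.finrank ℤ V) → ℤ) (2 : ℤ)).range =
      (DistribSMul.toAddMonoidHom V (2 : ℤ)).range.map (e.toAddEquiv : V →+ _) := by
    ext y
    constructor
    · rintro ⟨x, rfl⟩
      exact ⟨(2 : ℤ) • e.symm x, ⟨e.symm x, rfl⟩, by simp⟩
    · rintro ⟨_, ⟨x, rfl⟩, rfl⟩
      exact ⟨e x, by simp⟩
  rw [this, AddSubgroup.index_map_of_bijective]
  exact e.toAddEquiv.bijective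

theorem index_range_zsmul_two_of_finite (V : Type*) [AddCommGroup V] [Finite V] :
    (DistribSMul.toAddMonoidHom V (2 : ℤ)).range.index =
      Nat.card (DistribSMul.toAddMonoidHom V (2 : ℤ)).ker := by
  set f := DistribSMul.toAddMonoidHom V (2 : ℤ)
  have h1 := AddSubgroup.card_mul_index f.ker
  have h2 := AddSubgroup.card_mul_index f.range
  rw [AddSubgroup.index_ker] at h1
  have h3 : 0 < Nat.card f.range := Nat.card_pos
  apply Nat.eq_of_mul_eq_mul_left h3
  rw [h2, ← h1, mul_comm]

theorem index_range_zsmul_two (V : Type*) [AddCommGroup V] [Module.Finite ℤ V] :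
    (DistribSMul.toAddMonoidHom V (2 : ℤ)).range.index =
      2 ^ Module.finrank ℤ V * Nat.card (DistribSMul.toAddMonoidHom V (2 : ℤ)).ker := by
  set f := DistribSMul.toAddMonoidHom V (2 : ℤ) with hf
  let T := Submodule.torsion ℤ V
  have hfin : Finite T := Module.finite_of_fg_torsion _ (Submodule.torsion_isTorsion)
  have hrank : Module.finrank ℤ (V ⧸ T) = Module.finrank ℤ V :=
    finrank_quotient_eq_of_le_torsion le_rfl
  have hsat : ∀ x : V, (2 : ℤ) • x ∈ T → x ∈ T := by
    intro x hx
    rw [Submodule.mem_torsion_iff] at hx ⊢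
    obtain ⟨a, ha⟩ := hx
    refine ⟨⟨a * 2, mul_mem a.2 (by simp)⟩, ?_⟩
    rw [← ha]
    change ((a : ℤ) * 2) • x = (a : ℤ) • (2 : ℤ) • x
    rw [mul_smul]
  have e1 : (f.range ⊔ T.toAddSubgroup).index = 2 ^ Module.finrank ℤ V := by
    rw [← hrank, ← index_range_zsmul_two_of_free (V ⧸ T)]
    have : (DistribSMul.toAddMonoidHom (V ⧸ T) (2 : ℤ)).range =
        f.range.map (T.mkQ : V →ₗ[ℤ] V ⧸ T).toAddMonoidHom := by
      ext y
      constructor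
      · rintro ⟨x, rfl⟩
        obtain ⟨x, rfl⟩ := T.mkQ_surjective x
        exact ⟨(2 : ℤ) • x, ⟨x, rfl⟩, by simp⟩
      · rintro ⟨_, ⟨x, rfl⟩, rfl⟩
        exact ⟨T.mkQ x, by simp [hf]⟩
    rw [this, AddSubgroup.index_map]
    have h1 : (T.mkQ : V →ₗ[ℤ] V ⧸ T).toAddMonoidHom.range = ⊤ :=
      AddMonoidHom.range_eq_top.mpr T.mkQ_surjective
    have h2 : (T.mkQ : V →ₗ[ℤ] V ⧸ T).toAddMonoidHom.ker = T.toAddSubgroup := by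
      ext x; simp [AddMonoidHom.mem_ker]
    rw [h1, h2]; simp
  have e2 : f.range.relIndex (f.range ⊔ T.toAddSubgroup) = Nat.card f.ker := by
    rw [sup_comm, AddSubgroup.relIndex_sup_right]
    have h1 := index_range_zsmul_two_of_finite T
    have h2 : (DistribSMul.toAddMonoidHom T (2 : ℤ)).range =
        f.range.addSubgroupOf T.toAddSubgroup := by
      ext y
      rw [AddSubgroup.mem_addSubgroupOf]
      constructor
      · rintro ⟨x, rfl⟩
        exact ⟨x, rfl⟩
      · rintro ⟨x, hx⟩
        have hxT : x ∈ T := hsat x (by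
          change f x ∈ T
          rw [hx]; exact y.2)
        exact ⟨⟨x, hxT⟩, Subtype.ext hx⟩
    rw [h2] at h1
    refine h1.trans (Nat.card_congr ?_)
    refine ⟨fun x => ⟨x.1.1, ?_⟩, fun x => ⟨⟨x.1, ?_⟩, ?_⟩, fun x => rfl, fun x => rfl⟩
    · have := x.2
      rw [AddMonoidHom.mem_ker] at this ⊢
      exact congrArg Subtype.val this
    · exact hsat _ (by
        have := x.2
        rw [AddMonoidHom.mem_ker] at this
        change f x.1 ∈ T
        rw [this]; exact zero_mem _)
    · have := x.2
      rw [AddMonoidHom.mem_ker] at this ⊢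
      exact Subtype.ext this
  rw [← AddSubgroup.relIndex_mul_index (le_sup_left : f.range ≤ f.range ⊔ T.toAddSubgroup),
    e1, e2, mul_comm]

theorem relIndex_map_pow_two {E : Type*} [CommGroup E] [Module.Finite ℤ (Additive E)]
    (H : Subgroup E) (hcard : Nat.card {x : E // x ∈ H ∧ x ^ 2 = 1} = 2) :
    (H.map (powMonoidHom 2)).relIndex H =
      2 ^ (Module.finrank ℤ (AddSubgroup.toIntSubmodule (Subgroup.toAddSubgroup H)) + 1) := by
  set V := AddSubgroup.toIntSubmodule (Subgroup.toAddSubgroup H)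
  have h := index_range_zsmul_two V
  have hk : Nat.card (DistribSMul.toAddMonoidHom V (2 : ℤ)).ker = 2 := by
    rw [← hcard]
    refine Nat.card_congr ⟨fun x => ⟨x.1.1.toMul, x.1.2, ?_⟩,
      fun x => ⟨⟨Additive.ofMul x.1, x.2.1⟩, ?_⟩, fun x => rfl, fun x => rfl⟩
    · have := x.2
      rw [AddMonoidHom.mem_ker] at this
      have h3 : ((2 : ℤ) • (x.1 : Additive E)) = 0 := congrArg Subtype.val this
      have h4 : Additive.toMul ((2 : ℤ) • (x.1 : Additive E)) = 1 := by rw [h3]; rfl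
      rw [toMul_zsmul] at h4
      exact_mod_cast h4
    · rw [AddMonoidHom.mem_ker]
      apply Subtype.ext
      change (2 : ℤ) • Additive.ofMul x.1 = 0
      rw [← ofMul_zpow]
      have := x.2.2
      rw [show (2 : ℤ) = ((2 : ℕ) : ℤ) from rfl, zpow_natCast, this]; rfl
  rw [hk, ← pow_succ] at h
  rw [← h]
  let φ : Additive H →+ V :=
    { toFun := fun x => ⟨Additive.ofMul (x.toMul : E), x.toMul.2⟩
      map_zero' := rfl
      map_add' := fun _ _ => rfl }
  have hφ : Function.Surjective φ := fun x => ⟨Additive.ofMul ⟨x.1.toMul, x.2⟩, rfl⟩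
  rw [← AddSubgroup.index_comap_of_surjective _ hφ, Subgroup.relIndex,
    ← Subgroup.index_toAddSubgroup]
  congr 1
  ext x
  constructor
  · rintro ⟨y, hy, hyx⟩
    refine ⟨⟨Additive.ofMul y, hy⟩, Subtype.ext ?_⟩
    change (2 : ℤ) • Additive.ofMul y = Additive.ofMul (x.toMul : E)
    rw [two_zsmul, ← ofMul_mul, ← pow_two]
    exact congrArg Additive.ofMul hyx
  · rintro ⟨y, hy⟩
    refine ⟨y.1.toMul, y.2, ?_⟩
    have h1 : (2 : ℤ) • (y.1 : Additive E) = Additive.ofMul (x.toMul : E) :=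
      congrArg Subtype.val hy
    rw [two_zsmul] at h1
    change (y.1.toMul) ^ 2 = (x.toMul : E)
    rw [pow_two]
    exact congrArg Additive.toMul h1

end Rank

section Criterion

open Ideal UniqueFactorizationMonoid

variable {A B : Type*} [CommRing A] [IsDedekindDomain A]
  [CommRing B] [IsDedekindDomain B] [Algebra A B]

/-- The action of an automorphism on units. -/
def unitsConj (σ : B ≃ₐ[A] B) : Bˣ →* Bˣ := Units.map (σ : B →* B)

omit [IsDedekindDomain A] [IsDedekindDomain B] in
theorem coe_unitsConj (σ : B ≃ₐ[A] B) (u : Bˣ) : (unitsConj σ u : B) = σ u := rfl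

/-- If the product of two elements generates an extended ideal, then the two associated units of
relative norm one agree modulo the units `σ u / u`. -/
theorem div_mem_range_diffHom [Algebra.IsIntegral A B] [FaithfulSMul A B]
    (σ : B ≃ₐ[A] B) (hσ : ∀ x, σ (σ x) = x)
    (hfix : ∀ x, σ x = x → ∃ a, algebraMap A B a = x)
    (hA : ∀ J : Ideal A, (J ^ 2).IsPrincipal → J.IsPrincipal)
    (ε ε' : Bˣ) (hε' : ε' ∈ (normHom (unitsConj σ)).ker) (x x' : B)
    (hx0 : x ≠ 0) (hx0' : x' ≠ 0)
    (hx : σ x = ε * x) (hx' : σ x' = ε' * x')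
    (h : ∃ J : Ideal A, Ideal.span {x * x'} = J.map (algebraMap A B)) :
    ε / ε' ∈ (diffHom (unitsConj σ)).range := by
  obtain ⟨J, hJ⟩ := h
  have hJp : J.IsPrincipal := isPrincipal_of_isPrincipal_map σ hσ hfix hA J
    ⟨x * x', by rw [← hJ]⟩
  obtain ⟨j, rfl⟩ := hJp
  rw [Ideal.submodule_span_eq, Ideal.map_span, Set.image_singleton,
    Ideal.span_singleton_eq_span_singleton] at hJ
  obtain ⟨u, hu⟩ := hJ.symm
  have hj0 : algebraMap A B j ≠ 0 := by
    intro h0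
    rw [h0, zero_mul] at hu
    rcases mul_eq_zero.mp hu.symm with h | h
    · exact hx0 h
    · exact hx0' h
  have hu2 : (σ u : B) = ε * ε' * u := by
    have h1 := congrArg σ hu
    rw [map_mul, map_mul, σ.commutes, hx, hx'] at h1
    apply mul_left_cancel₀ hj0
    rw [h1]
    linear_combination (-(ε : B) * ε') * hu
  have h1 : ε * ε' = diffHom (unitsConj σ) u := by
    rw [diffHom_apply, eq_div_iff_mul_eq']
    ext
    rw [coe_unitsConj, hu2]
    push_cast
    ring
  have h2 : ε' ^ 2 = diffHom (unitsConj σ) ε'⁻¹ := by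
    rw [mem_ker_normHom] at hε'
    rw [diffHom_apply, map_inv, ← eq_inv_of_mul_eq_one_left hε', pow_two, div_inv_eq_mul]
  have h3 : ε / ε' = ε * ε' / ε' ^ 2 := by
    rw [pow_two, mul_div_mul_right_eq_div]
  rw [h3, h1, h2]
  exact div_mem ⟨_, rfl⟩ ⟨_, rfl⟩

omit [IsDedekindDomain A] [IsDedekindDomain B] in
theorem exists_unit_conj_eq (σ : B ≃ₐ[A] B) (hσ : ∀ x, σ (σ x) = x) {τ : B} (hτ : σ τ = -τ)
    (hτ0 : τ ≠ 0) (ε : Bˣ) (hε : ε ∈ (normHom (unitsConj σ)).ker) :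
    ∃ x, x ≠ 0 ∧ σ x = ε * x := by
  have h1 : (ε : B) * σ ε = 1 * 1 := by
    rw [mem_ker_normHom] at hε
    have := congrArg Units.val hε
    exact this.trans (mul_one 1).symm
  obtain ⟨z, hz0, hz⟩ := exists_conj_mul_eq σ hσ hτ hτ0 1 ε (map_one σ) h1
  exact ⟨z, hz0, by rw [one_mul] at hz; rw [← hz, mul_comm]⟩

/-- The ambiguous class number estimate: if `A` has odd class number, there are at most two bad
primes, and (when there are two of them) some unit of `A` is not a norm, then the class group of
`B` has no element of order two. -/
theorem isPrincipal_of_sq_isPrincipal [Algebra.IsIntegral A B] [FaithfulSMul A B]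
    [Finite (ClassGroup A)] (hcl : Odd (Nat.card (ClassGroup A)))
    (σ : B ≃ₐ[A] B) (hσ : ∀ x, σ (σ x) = x)
    (hfix : ∀ x, σ x = x → ∃ a, algebraMap A B a = x)
    {τ : B} (hτ : σ τ = -τ) (hτ0 : τ ≠ 0) (T : Set (Ideal B)) (hTfin : T.Finite)
    (hT : ∀ P : Ideal B, P.IsPrime → P ≠ ⊥ → P.map σ = P → P ∉ T →
      ∃ J : Ideal A, P = J.map (algebraMap A B))
    (hTinv : ∀ P ∈ T, P.map σ = P)
    (hidx : (diffHom (unitsConj σ)).range.relIndex (normHom (unitsConj σ)).ker =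
      2 * (normHom (unitsConj σ)).range.relIndex (diffHom (unitsConj σ)).ker)
    (hidx0 : (normHom (unitsConj σ)).range.relIndex (diffHom (unitsConj σ)).ker ≠ 0)
    (hcard : T.ncard ≤ 1 ∨ T.ncard ≤ 2 ∧ ∃ u : Bˣ, σ u = u ∧
      ∀ x y : B, y ≠ 0 → x * σ x ≠ u * (y * σ y))
    (I : Ideal B) (hI2 : (I ^ 2).IsPrincipal) : I.IsPrincipal := by
  classical
  have := Fintype.ofFinite (ClassGroup A)
  rw [Nat.card_eq_fintype_card] at hcl
  have hA : ∀ J : Ideal A, (J ^ 2).IsPrincipal → J.IsPrincipal := fun J hJ =>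
    Ideal.IsPrincipal.of_isPrincipal_pow_of_coprime
      (Nat.coprime_two_left.mpr hcl) hJ
  set N := normHom (unitsConj σ) with hN
  set M := diffHom (unitsConj σ) with hM
  have hss : ∀ x, unitsConj σ (unitsConj σ x) = x := fun x => Units.ext (hσ x)
  have hspaninv : ∀ (ε : Bˣ) (x : B), σ x = ε * x → (Ideal.span {x}).map σ = Ideal.span {x} := by
    intro ε x h
    rw [Ideal.map_span, Set.image_singleton, Ideal.span_singleton_eq_span_singleton]
    exact ⟨ε⁻¹, by rw [h, mul_comm (ε : B), mul_assoc, Units.mul_inv, mul_one]⟩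
  -- parity vectors
  let v : Ideal B → T → ZMod 2 := fun I P => ((normalizedFactors I).count P.1 : ZMod 2)
  have hvmul : ∀ I I' : Ideal B, I ≠ ⊥ → I' ≠ ⊥ → v (I * I') = v I + v I' := by
    intro I I' h h'
    ext P
    simp only [v, Pi.add_apply]
    rw [normalizedFactors_mul h h', Multiset.count_add, Nat.cast_add]
  have hveven : ∀ I : Ideal B, I ≠ ⊥ → I.map σ = I → v I = 0 →
      ∃ J : Ideal A, I = J.map (algebraMap A B) := by
    intro I h0 hinv hv
    refine exists_map_eq_of_even_count σ hσ hfix T hT hTinv I h0 hinv fun P hP => ?_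
    rw [← ZMod.natCast_eq_zero_iff_even]
    exact congrFun hv ⟨P, hP⟩
  have hself : ∀ w : T → ZMod 2, w + w = 0 := fun w => by
    ext P; exact CharTwo.add_self_eq_zero _
  choose! X hX0 hX using exists_unit_conj_eq σ hσ hτ hτ0
  let Q := N.ker ⧸ M.range.subgroupOf N.ker
  have hQcard : Nat.card Q = M.range.relIndex N.ker := rfl
  let g : Q → T → ZMod 2 := fun c => v (Ideal.span {X (c.out : N.ker).1})
  have hg : Function.Injective g := by
    intro c d hcd
    have hc := (c.out : N.ker).2
    have hd := (d.out : N.ker).2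
    set ε := (c.out : N.ker).1 with hε
    set ε' := (d.out : N.ker).1 with hε'
    have h1 : ε / ε' ∈ M.range := by
      refine div_mem_range_diffHom σ hσ hfix hA ε ε' hd (X ε) (X ε') (hX0 _ hc) (hX0 _ hd)
        (hX _ hc) (hX _ hd) ?_
      apply hveven
      · simpa using ⟨hX0 _ hc, hX0 _ hd⟩
      · refine hspaninv (ε * ε') _ ?_
        rw [map_mul, hX _ hc, hX _ hd]
        push_cast
        ring
      · rw [← Ideal.span_singleton_mul_span_singleton, hvmul _ _ (by simpa using hX0 _ hc)
          (by simpa using hX0 _ hd)]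
        have : v (Ideal.span {X ε}) = v (Ideal.span {X ε'}) := hcd
        rw [this, hself]
    rw [← c.out_eq, ← d.out_eq]
    refine (QuotientGroup.eq_iff_div_mem).mpr ?_
    rw [Subgroup.mem_subgroupOf]
    exact h1
  have hTfin' : Finite T := hTfin
  have hTcard : Nat.card (T → ZMod 2) = 2 ^ T.ncard := by
    have := Fintype.ofFinite T
    rw [Nat.card_fun, Nat.card_zmod, Nat.card_coe_set_eq]
  have hle : 2 * N.range.relIndex M.ker ≤ 2 ^ T.ncard := by
    rw [← hTcard, ← hidx, ← hQcard]
    exact Nat.card_le_card_of_injective g hg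
  have hNle : N.range ≤ M.ker := range_normHom_le _ hss
  obtain ⟨heq, hnorm⟩ : 2 * N.range.relIndex M.ker = 2 ^ T.ncard ∧
      ∀ u : Bˣ, σ u = u → (∃ x y : B, y ≠ 0 ∧ x * σ x = u * (y * σ y)) → u ∈ N.range := by
    have hker : ∀ u : Bˣ, σ u = u → u ∈ M.ker := fun u hu =>
      (mem_ker_diffHom _).mpr (Units.ext hu)
    rcases hcard with h | ⟨h, w, hw, hwn⟩
    · have h1 : 2 ^ T.ncard ≤ 2 ^ 1 := Nat.pow_le_pow_right (by norm_num) h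
      have h2 : N.range.relIndex M.ker = 1 := by omega
      refine ⟨by omega, fun u hu _ => ?_⟩
      rw [Subgroup.relIndex_eq_one] at h2
      exact h2 (hker u hu)
    · have h1 : 2 ^ T.ncard ≤ 2 ^ 2 := Nat.pow_le_pow_right (by norm_num) h
      have hwN : w ∉ N.range := by
        rintro ⟨ε, hε⟩
        refine hwn ε 1 one_ne_zero ?_
        rw [← hε, map_one, mul_one, mul_one]; rfl
      have hne1 : N.range.relIndex M.ker ≠ 1 := by
        rw [Ne, Subgroup.relIndex_eq_one]
        exact fun h => hwN (h (hker w hw))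
      have h2 : N.range.relIndex M.ker = 2 := by omega
      refine ⟨by omega, fun u hu ⟨x, y, hy, hxy⟩ => ?_⟩
      by_contra huN
      have h3 : u * w ∈ N.range := by
        have := (Subgroup.mul_mem_iff_of_index_two (H := N.range.subgroupOf M.ker) h2
          (a := ⟨u, hker u hu⟩) (b := ⟨w, hker w hw⟩)).mpr
          (by simp only [Subgroup.mem_subgroupOf]; tauto)
        exact this
      obtain ⟨ε, hε⟩ := h3
      have hε' : (ε : B) * σ ε = u * w := congrArg Units.val hε
      have hx0 : x ≠ 0 := by
        rintro rfl
        rw [zero_mul] at hxy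
        rcases mul_eq_zero.mp hxy.symm with h | h
        · exact u.ne_zero h
        · rcases mul_eq_zero.mp h with h | h
          · exact hy h
          · exact hy (by simpa using h)
      refine hwn (ε * y) x hx0 ?_
      rw [map_mul, hxy]
      linear_combination (y * σ y) * hε'
  have hsurj : Function.Surjective g := by
    have : Nat.card Q = Nat.card (T → ZMod 2) := by rw [hQcard, hTcard, ← heq, hidx]
    have hfinQ : Finite Q := Finite.of_injective g hg
    exact ((Nat.bijective_iff_injective_and_card g).mpr ⟨hg, this⟩).2
  -- the ideal class of `I`
  by_cases hI0 : I = ⊥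
  · rw [hI0]; exact bot_isPrincipal
  obtain ⟨b, hb⟩ := hI2
  rw [Ideal.submodule_span_eq] at hb
  have hb0 : b ≠ 0 := by
    rintro rfl
    rw [Ideal.span_singleton_eq_bot.mpr rfl] at hb
    exact hI0 (pow_eq_zero_iff (two_ne_zero) |>.mp hb)
  obtain ⟨J, hJ⟩ := exists_map_eq_mul_conj σ hσ hfix I
  have hσb : (I.map σ) ^ 2 = Ideal.span {σ b} := by
    rw [← Ideal.map_pow, hb, Ideal.map_span, Set.image_singleton]
  have hσb0 : σ b ≠ 0 := by simpa using hb0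
  have hJp : J.IsPrincipal := by
    apply hA
    apply isPrincipal_of_isPrincipal_map σ hσ hfix hA
    refine ⟨b * σ b, ?_⟩
    rw [Ideal.map_pow, ← hJ, mul_pow, hb, hσb, Ideal.span_singleton_mul_span_singleton]
  obtain ⟨n₀, rfl⟩ := hJp
  set n := algebraMap A B n₀ with hn
  rw [Ideal.submodule_span_eq, Ideal.map_span, Set.image_singleton, ← hn] at hJ
  have hσn : σ n = n := σ.commutes n₀
  have hI0' : I.map σ ≠ ⊥ := fun h => hI0 (by
    rw [← map_conj_map_conj σ hσ I, h, Ideal.map_bot])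
  have hn0 : n ≠ 0 := by
    intro h
    rw [h, Ideal.span_singleton_eq_bot.mpr rfl] at hJ
    exact (mul_ne_zero hI0 hI0') hJ
  have hassoc : Associated (b * σ b) (n * n) := by
    rw [← Ideal.span_singleton_eq_span_singleton, ← Ideal.span_singleton_mul_span_singleton,
      ← Ideal.span_singleton_mul_span_singleton, ← hJ, ← hb, ← hσb]
    ring
  obtain ⟨u, hu⟩ := hassoc
  have hu_fix : σ u = u := by
    have h1 := congrArg σ hu
    simp only [map_mul, hσ, hσn] at h1
    apply mul_left_cancel₀ (mul_ne_zero hb0 hσb0)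
    rw [hu, ← h1]; ring
  obtain ⟨ε, hε⟩ := hnorm u hu_fix ⟨n, b, hb0, by rw [hσn, ← hu]; ring⟩
  have hε' : (ε : B) * σ ε = u := congrArg Units.val hε
  obtain ⟨z, hz0, hz⟩ := exists_conj_mul_eq σ hσ hτ hτ0 n (ε * b) hσn
    (by rw [map_mul, ← hu]; linear_combination (b * σ b) * hε')
  have hinv : (Ideal.span {z} * I).map σ = Ideal.span {z} * I := by
    rw [Ideal.map_mul, Ideal.map_span, Set.image_singleton]
    have hne : Ideal.span {n} * I ≠ ⊥ := mul_ne_zero (by simpa using hn0) hI0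
    apply mul_right_cancel₀ hne
    calc Ideal.span {σ z} * I.map σ * (Ideal.span {n} * I)
        = Ideal.span {n * σ z} * (I * I.map σ) := by
          rw [← Ideal.span_singleton_mul_span_singleton]; ring
      _ = Ideal.span {z} * Ideal.span {b} * Ideal.span {n} := by
          rw [← hz, hJ]
          congr 1
          rw [Ideal.span_singleton_mul_span_singleton, Ideal.span_singleton_eq_span_singleton]
          exact (Associated.symm ⟨ε, by ring⟩)
      _ = Ideal.span {z} * I * (Ideal.span {n} * I) := by rw [← hb]; ring
  obtain ⟨c, hc⟩ := hsurj (v (Ideal.span {z} * I))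
  have hcm := (c.out : N.ker).2
  set x := X (c.out : N.ker).1 with hx
  have hx0 : x ≠ 0 := hX0 _ hcm
  have hxspan : Ideal.span {x} ≠ ⊥ := by simpa using hx0
  have hzI : Ideal.span {z} * I ≠ ⊥ := mul_ne_zero (by simpa using hz0) hI0
  obtain ⟨K, hK⟩ := hveven (Ideal.span {x} * (Ideal.span {z} * I)) (mul_ne_zero hxspan hzI)
    (by rw [Ideal.map_mul, hinv, hspaninv _ _ (hX _ hcm)])
    (by
      rw [hvmul _ _ hxspan hzI, ← hc]
      exact hself _)
  have hK2 : (K ^ 2).IsPrincipal := by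
    apply isPrincipal_of_isPrincipal_map σ hσ hfix hA
    refine ⟨(x * z) ^ 2 * b, ?_⟩
    rw [Ideal.map_pow, ← hK, ← mul_assoc, mul_pow, hb, Ideal.span_singleton_mul_span_singleton,
      Ideal.span_singleton_pow, Ideal.span_singleton_mul_span_singleton]
  obtain ⟨k, hk⟩ := hA K hK2
  rw [Ideal.submodule_span_eq] at hk
  rw [hk, Ideal.map_span, Set.image_singleton, ← mul_assoc,
    Ideal.span_singleton_mul_span_singleton] at hK
  have hkmem : algebraMap A B k ∈ Ideal.span {x * z} * I := hK ▸ Ideal.mem_span_singleton_self _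
  obtain ⟨y, -, hy⟩ := Ideal.mem_span_singleton_mul.mp hkmem
  refine ⟨y, ?_⟩
  rw [Ideal.submodule_span_eq]
  apply mul_left_cancel₀ (show Ideal.span {x * z} ≠ ⊥ by simpa using ⟨hx0, hz0⟩)
  rw [hK, ← hy, Ideal.span_singleton_mul_span_singleton]

end Criterion

section UnitRank

open Ideal UniqueFactorizationMonoid NumberField

theorem finrank_range_add_finrank_ker_int {V W : Type*} [AddCommGroup V] [AddCommGroup W]
    [Module.Finite ℤ V] (f : V →ₗ[ℤ] W) :
    Module.finrank ℤ f.range + Module.finrank ℤ f.ker = Module.finrank ℤ V := by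
  rw [← Submodule.finrank_quotient_add_finrank f.ker, f.quotKerEquivRange.finrank_eq]

variable {E : Type*} [CommGroup E] [Module.Finite ℤ (Additive E)] (s : E →* E)

theorem finrank_ker_normHom_add_finrank_ker_diffHom (hs : ∀ x, s (s x) = x) :
    Module.finrank ℤ (AddSubgroup.toIntSubmodule (Subgroup.toAddSubgroup (normHom s).ker)) +
      Module.finrank ℤ (AddSubgroup.toIntSubmodule (Subgroup.toAddSubgroup (diffHom s).ker)) =
    Module.finrank ℤ (Additive E) := by
  let f : Additive E →ₗ[ℤ] Additive E := (MonoidHom.toAdditive (normHom s)).toIntLinearMap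
  let D := AddSubgroup.toIntSubmodule (Subgroup.toAddSubgroup (diffHom s).ker)
  have hker : AddSubgroup.toIntSubmodule (Subgroup.toAddSubgroup (normHom s).ker) = f.ker := by
    ext x; rfl
  have hrange : f.range ≤ D := by
    rintro _ ⟨x, rfl⟩
    exact range_normHom_le s hs ⟨x.toMul, rfl⟩
  let g : D →ₗ[ℤ] Additive E := (2 : ℤ) • D.subtype
  have hg : g.range ≤ f.range := by
    rintro _ ⟨x, rfl⟩
    refine ⟨x.1, ?_⟩
    have hx : s x.1.toMul = x.1.toMul := (mem_ker_diffHom s).mp x.2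
    change Additive.ofMul (x.1.toMul * s x.1.toMul) = (2 : ℤ) • x.1
    rw [hx, two_zsmul]; rfl
  have hgk : Module.finrank ℤ g.ker = 0 := by
    rw [Module.finrank_eq_zero_iff_isTorsion]
    intro x
    refine ⟨⟨2, by simp⟩, ?_⟩
    exact Subtype.ext (Subtype.ext x.2)
  have h1 := finrank_range_add_finrank_ker_int g
  have h2 := finrank_range_add_finrank_ker_int f
  have h3 := Submodule.finrank_mono hrange
  have h4 := Submodule.finrank_mono hg
  rw [hker]
  change _ + Module.finrank ℤ D = _
  omega

/-- The Herbrand quotient of the units of a totally real quadratic extension, in terms of ranks. -/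
theorem relIndex_range_diffHom_eq (hs : ∀ x, s (s x) = x) (n : ℕ)
    (hE : Module.finrank ℤ (Additive E) = 2 * n + 1)
    (hD : Module.finrank ℤ (AddSubgroup.toIntSubmodule (Subgroup.toAddSubgroup (diffHom s).ker))
      = n) (e : E) (he : s e = e) (he1 : e ≠ 1) (htors : ∀ x : E, x ^ 2 = 1 ↔ x = 1 ∨ x = e) :
    (diffHom s).range.relIndex (normHom s).ker = 2 * (normHom s).range.relIndex (diffHom s).ker ∧
      (normHom s).range.relIndex (diffHom s).ker ≠ 0 := by
  have he2 : e ^ 2 = 1 := (htors e).mpr (Or.inr rfl)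
  have hcard : ∀ H : Subgroup E, e ∈ H → Nat.card {x : E // x ∈ H ∧ x ^ 2 = 1} = 2 := by
    intro H hH
    have : {x : E | x ∈ H ∧ x ^ 2 = 1} = {1, e} := by
      ext x
      simp only [Set.mem_ofPred_eq, Set.mem_insert_iff, Set.mem_singleton_iff, htors]
      refine ⟨fun h => h.2, fun h => ⟨?_, h⟩⟩
      rcases h with rfl | rfl
      exacts [one_mem _, hH]
    change Nat.card ({x : E | x ∈ H ∧ x ^ 2 = 1} : Set E) = 2
    rw [this, Nat.card_coe_set_eq, Set.ncard_pair he1.symm]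
  have hN := finrank_ker_normHom_add_finrank_ker_diffHom s hs
  have h1 := relIndex_map_pow_two _ (hcard (diffHom s).ker ((mem_ker_diffHom s).mpr he))
  have h2 := relIndex_map_pow_two _ (hcard (normHom s).ker
    ((mem_ker_normHom s).mpr (by rw [he, ← pow_two, he2])))
  refine relIndex_range_normHom_mul s hs (by rw [h1]; positivity) 2 ?_
  rw [h1, h2, hD, show Module.finrank ℤ (AddSubgroup.toIntSubmodule
    (Subgroup.toAddSubgroup (normHom s).ker)) = n + 1 by omega]
  ring

end UnitRank

section NumberField

open Ideal UniqueFactorizationMonoid NumberField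

variable {K L : Type*} [Field K] [Field L] [NumberField K] [NumberField L] [Algebra K L]

theorem finrank_units_of_isTotallyReal (K : Type*) [Field K] [NumberField K] [IsTotallyReal K] :
    Module.finrank ℤ (Additive (𝓞 K)ˣ) = Module.finrank ℚ K - 1 := by
  rw [Units.finrank_eq, Units.rank, IsTotallyReal.finrank,
    InfinitePlace.card_eq_nrRealPlaces_add_nrComplexPlaces,
    IsTotallyReal.nrComplexPlaces_eq_zero, add_zero]

omit [NumberField K] [NumberField L] in
theorem finrank_ker_diffHom_units (σ : 𝓞 L ≃ₐ[𝓞 K] 𝓞 L)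
    (hfix : ∀ x, σ x = x → ∃ a, algebraMap (𝓞 K) (𝓞 L) a = x) :
    Module.finrank ℤ (AddSubgroup.toIntSubmodule
      (Subgroup.toAddSubgroup (diffHom (unitsConj σ)).ker)) =
    Module.finrank ℤ (Additive (𝓞 K)ˣ) := by
  have hinj : Function.Injective (algebraMap (𝓞 K) (𝓞 L)) := FaithfulSMul.algebraMap_injective _ _
  let φ : (𝓞 K)ˣ →* (𝓞 L)ˣ := Units.map (algebraMap (𝓞 K) (𝓞 L))
  have hφ : Function.Injective φ := Units.map_injective hinj
  let f : Additive (𝓞 K)ˣ →ₗ[ℤ] Additive (𝓞 L)ˣ := (MonoidHom.toAdditive φ).toIntLinearMap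
  have hr : AddSubgroup.toIntSubmodule (Subgroup.toAddSubgroup (diffHom (unitsConj σ)).ker) =
      f.range := by
    ext x
    constructor
    · intro hx
      have hx' : unitsConj σ x.toMul = x.toMul := (mem_ker_diffHom _).mp hx
      obtain ⟨a, ha⟩ := hfix _ (congrArg Units.val hx')
      obtain ⟨b, hb⟩ := hfix ((x.toMul⁻¹ : (𝓞 L)ˣ) : 𝓞 L)
        (congrArg Units.val (show unitsConj σ x.toMul⁻¹ = x.toMul⁻¹ by rw [map_inv, hx']))
      have hab : a * b = 1 := hinj (by rw [map_mul, ha, hb, Units.mul_inv, map_one])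
      exact ⟨Additive.ofMul ⟨a, b, hab, by rw [mul_comm, hab]⟩,
        congrArg Additive.ofMul (Units.ext ha)⟩
    · rintro ⟨y, rfl⟩
      exact (mem_ker_diffHom (unitsConj σ) (x := φ y.toMul)).mpr (Units.ext (σ.commutes _))
  rw [hr]
  exact LinearMap.finrank_range_of_inj hφ

theorem relIndex_units [IsTotallyReal K] [IsTotallyReal L] (hKL : Module.finrank K L = 2)
    (σ : 𝓞 L ≃ₐ[𝓞 K] 𝓞 L) (hσ : ∀ x, σ (σ x) = x)
    (hfix : ∀ x, σ x = x → ∃ a, algebraMap (𝓞 K) (𝓞 L) a = x) :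
    (diffHom (unitsConj σ)).range.relIndex (normHom (unitsConj σ)).ker =
        2 * (normHom (unitsConj σ)).range.relIndex (diffHom (unitsConj σ)).ker ∧
      (normHom (unitsConj σ)).range.relIndex (diffHom (unitsConj σ)).ker ≠ 0 := by
  have hn : Module.finrank ℚ K * Module.finrank K L = Module.finrank ℚ L :=
    Module.finrank_mul_finrank ℚ K L
  have hpos : 0 < Module.finrank ℚ K := Module.finrank_pos
  refine relIndex_range_diffHom_eq _ (fun x => Units.ext (hσ x)) (Module.finrank ℚ K - 1) ?_ ?_
    (-1) (Units.ext (by simp [coe_unitsConj])) ?_ ?_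
  · rw [finrank_units_of_isTotallyReal, ← hn, hKL]; omega
  · rw [finrank_ker_diffHom_units σ hfix, finrank_units_of_isTotallyReal]
  · intro h
    have h1 := congrArg Units.val h
    simp at h1
    norm_num at h1
  · intro x
    rw [Units.ext_iff, Units.ext_iff, Units.ext_iff]
    exact sq_eq_one_iff

omit [NumberField L] in
theorem exists_conj [Algebra.IsQuadraticExtension K L] {r : L} {d : K}
    (hr : r ^ 2 = algebraMap K L d)
    (hrK : r ∉ Set.range (algebraMap K L)) :
    ∃ σ : L ≃ₐ[K] L, σ r = -r ∧ (∀ x, σ (σ x) = x) ∧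
      ∀ x, σ x = x → x ∈ Set.range (algebraMap K L) := by
  have hcard : Nat.card Gal(L/K) = 2 := by
    rw [IsGalois.card_aut_eq_finrank, Algebra.IsQuadraticExtension.finrank_eq_two]
  obtain ⟨σ, hσ⟩ : ∃ σ : Gal(L/K), σ r ≠ r := by
    by_contra! h
    exact hrK ((IsGalois.mem_range_algebraMap_iff_fixed r).mpr h)
  refine ⟨σ, ?_, fun x => ?_, fun x hx => ?_⟩
  · have h : (σ r) ^ 2 = r ^ 2 := by rw [← map_pow, hr, σ.commutes]
    exact (sq_eq_sq_iff_eq_or_eq_neg.mp h).resolve_left hσ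
  · have h : σ ^ 2 = 1 := by rw [← hcard]; exact pow_card_eq_one'
    exact DFunLike.congr_fun h x
  · rw [IsGalois.mem_range_algebraMap_iff_fixed]
    intro g
    obtain ⟨y, -, hy⟩ := (Nat.card_eq_two_iff' (1 : Gal(L/K))).mp hcard
    by_cases hg : g = 1
    · rw [hg]; rfl
    · rw [hy g hg, ← hy σ (fun h => hσ (by rw [h]; rfl)), hx]

/-- A conjugation-invariant prime is determined by its restriction. -/
theorem eq_of_comap_eq_of_map_conj_eq {A B : Type*} [CommRing A] [CommRing B] [Algebra A B]
    (σ : B ≃ₐ[A] B) (hσ : ∀ x, σ (σ x) = x)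
    (hfix : ∀ x, σ x = x → ∃ a, algebraMap A B a = x) {P P' : Ideal B} [P.IsPrime] [P'.IsPrime]
    (hP : P.map σ = P) (hP' : P'.map σ = P')
    (h : P.comap (algebraMap A B) = P'.comap (algebraMap A B)) : P = P' := by
  have key : ∀ {Q Q' : Ideal B}, Q'.IsPrime → Q'.map σ = Q' →
      Q.comap (algebraMap A B) = Q'.comap (algebraMap A B) → Q ≤ Q' := by
    intro Q Q' hQp hQ hQQ x hx
    obtain ⟨a, ha⟩ := hfix (x * σ x) (by rw [map_mul, hσ, mul_comm])
    have h1 : a ∈ Q.comap (algebraMap A B) := by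
      rw [mem_comap, ha]; exact Q.mul_mem_right _ hx
    rw [hQQ, mem_comap, ha] at h1
    rcases hQp.mem_or_mem h1 with h2 | h2
    · exact h2
    · rw [← hσ x, ← hQ]; exact mem_map_of_mem _ h2
  exact le_antisymm (key inferInstance hP' h) (key inferInstance hP h.symm)

theorem odd_card_classGroup_of_sq_isPrincipal {B : Type*} [CommRing B] [IsDedekindDomain B]
    [Finite (ClassGroup B)] (h : ∀ I : Ideal B, (I ^ 2).IsPrincipal → I.IsPrincipal) :
    Odd (Nat.card (ClassGroup B)) := by
  rw [← Nat.not_even_iff_odd, even_iff_two_dvd]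
  intro h2
  obtain ⟨c, hc⟩ := exists_prime_orderOf_dvd_card' 2 h2
  obtain ⟨I, rfl⟩ := ClassGroup.mk0_surjective c
  have hI : ClassGroup.mk0 I ^ 2 = 1 := by rw [← hc]; exact pow_orderOf_eq_one _
  rw [← map_pow, ClassGroup.mk0_eq_one_iff] at hI
  have h1 : ClassGroup.mk0 I = 1 := by
    rw [ClassGroup.mk0_eq_one_iff]
    exact h _ hI
  rw [h1, orderOf_one] at hc
  norm_num at hc

/-- Oddness of the class number ascends in a totally real quadratic extension in which few primes
are bad. -/
theorem odd_card_classGroup_of_isQuadraticExtension [IsTotallyReal K] [IsTotallyReal L]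
    [Algebra.IsQuadraticExtension K L] (hK : Odd (Nat.card (ClassGroup (𝓞 K))))
    (r : 𝓞 L) (d : 𝓞 K) (hr : r ^ 2 = algebraMap (𝓞 K) (𝓞 L) d)
    (hrK : (r : L) ∉ Set.range (algebraMap K L)) (θ : 𝓞 L) (D : 𝓞 K)
    (hθ : ∀ σ : 𝓞 L ≃ₐ[𝓞 K] 𝓞 L, σ r = -r → θ - σ θ ∣ algebraMap (𝓞 K) (𝓞 L) D)
    (hcard : {P : Ideal (𝓞 K) | P.IsPrime ∧ D ∈ P}.encard ≤ 1 ∨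
      {P : Ideal (𝓞 K) | P.IsPrime ∧ D ∈ P}.encard ≤ 2 ∧ ∃ u : (𝓞 K)ˣ,
        ∀ σ : 𝓞 L ≃ₐ[𝓞 K] 𝓞 L, σ r = -r → (∀ x, σ (σ x) = x) →
          (∀ x, σ x = x → ∃ a, algebraMap (𝓞 K) (𝓞 L) a = x) → ∀ x y : 𝓞 L, y ≠ 0 →
          x * σ x ≠ algebraMap (𝓞 K) (𝓞 L) u * (y * σ y)) :
    Odd (Nat.card (ClassGroup (𝓞 L))) := by
  obtain ⟨s, hsr, hss, hsfix⟩ := exists_conj (r := (r : L)) (d := (d : K))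
    (congrArg (algebraMap (𝓞 L) L) hr) hrK
  let σ : 𝓞 L ≃ₐ[𝓞 K] 𝓞 L := RingOfIntegers.mapAlgEquiv s
  have hσ : ∀ x, σ (σ x) = x := fun x => RingOfIntegers.ext (hss x)
  have hσr : σ r = -r := RingOfIntegers.ext hsr
  have hfix : ∀ x, σ x = x → ∃ a, algebraMap (𝓞 K) (𝓞 L) a = x := by
    intro x hx
    obtain ⟨a, ha⟩ := hsfix x (congrArg (algebraMap (𝓞 L) L) hx)
    have hai : IsIntegral ℤ a := by
      rw [← isIntegral_algebraMap_iff (FaithfulSMul.algebraMap_injective K L), ha]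
      exact RingOfIntegers.isIntegral_coe x
    exact ⟨⟨a, hai⟩, RingOfIntegers.ext ha⟩
  have hr0 : r ≠ 0 := by
    rintro rfl
    exact hrK ⟨0, by simp⟩
  obtain ⟨hidx, hidx0⟩ := relIndex_units (Algebra.IsQuadraticExtension.finrank_eq_two K L)
    σ hσ hfix
  let S : Set (Ideal (𝓞 K)) := {P | P.IsPrime ∧ D ∈ P}
  let T : Set (Ideal (𝓞 L)) :=
    {P | P.IsPrime ∧ P.map σ = P ∧ algebraMap (𝓞 K) (𝓞 L) D ∈ P}
  have hSfin : S.Finite := by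
    rw [← Set.encard_lt_top_iff]
    rcases hcard with h | ⟨h, -⟩
    · exact h.trans_lt (by decide)
    · exact h.trans_lt (by decide)
  have hmaps : Set.MapsTo (comap (algebraMap (𝓞 K) (𝓞 L))) T S := fun P hP =>
    ⟨hP.1.comap _, hP.2.2⟩
  have hinj : Set.InjOn (comap (algebraMap (𝓞 K) (𝓞 L))) T := by
    intro P hP P' hP' h
    have := hP.1
    have := hP'.1
    exact eq_of_comap_eq_of_map_conj_eq σ hσ hfix hP.2.1 hP'.2.1 h
  have hTfin : T.Finite := Set.Finite.of_injOn hmaps hinj hSfin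
  have hTS : T.ncard ≤ S.ncard := Set.ncard_le_ncard_of_injOn _ hmaps hinj hSfin
  have hScast : (S.ncard : ℕ∞) = S.encard := hSfin.cast_ncard_eq
  refine odd_card_classGroup_of_sq_isPrincipal fun I hI =>
    isPrincipal_of_sq_isPrincipal hK σ hσ hfix hσr hr0 T hTfin ?_ (fun P hP => hP.2.1) hidx hidx0
      ?_ I hI
  · intro P hPp hP0 hPinv hPT
    refine exists_map_eq_of_conj_sub_notMem σ hσ hfix P hPp hP0 hPinv θ fun hmem => hPT ?_
    exact ⟨hPp, hPinv, P.mem_of_dvd (hθ σ hσr) hmem⟩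
  · rcases hcard with h | ⟨h, u, hu⟩
    · left
      refine hTS.trans ?_
      exact_mod_cast hScast.trans_le h
    · right
      refine ⟨hTS.trans ?_, Units.map (algebraMap (𝓞 K) (𝓞 L) : 𝓞 K →* 𝓞 L) u, σ.commutes _,
        hu σ hσr hσ hfix⟩
      exact_mod_cast hScast.trans_le h

end NumberField

section Primes

open Ideal NumberField

variable {K : Type*} [Field K] [NumberField K]

theorem ne_bot_of_natCast_mem {ℓ : ℕ} (hℓ : ℓ ≠ 0) {P : Ideal (𝓞 K)} (hP : (ℓ : 𝓞 K) ∈ P) :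
    P ≠ ⊥ := by
  rintro rfl
  exact hℓ (by exact_mod_cast (mem_bot.mp hP))

theorem exists_absNorm_eq_pow {ℓ : ℕ} (hℓ : ℓ.Prime) {P : Ideal (𝓞 K)} (hPp : P.IsPrime)
    (hP : (ℓ : 𝓞 K) ∈ P) : ∃ j, absNorm P = ℓ ^ (j + 1) := by
  have h : absNorm P ∣ ℓ ^ Module.finrank ℤ (𝓞 K) := by
    have := absNorm_dvd_absNorm_of_le ((span_singleton_le_iff_mem P).mpr hP)
    rwa [absNorm_span_natCast] at this
  obtain ⟨j, -, hj⟩ := (Nat.dvd_prime_pow hℓ).mp h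
  rcases j with _ | j
  · exact absurd (absNorm_eq_one_iff.mp (by rw [hj, pow_zero])) hPp.ne_top
  · exact ⟨j, hj⟩

theorem pow_sub_mem_of_absNorm_eq {ℓ : ℕ} {P : Ideal (𝓞 K)} (hPm : P.IsMaximal)
    (h : absNorm P = ℓ) (hℓ : ℓ ≠ 0) (x : 𝓞 K) : x ^ ℓ - x ∈ P := by
  have hfin : Finite (𝓞 K ⧸ P) := by
    apply Nat.finite_of_card_ne_zero
    rw [← h] at hℓ
    exact hℓ
  have := Fintype.ofFinite (𝓞 K ⧸ P)
  let := Ideal.Quotient.field P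
  have hc : Fintype.card (𝓞 K ⧸ P) = ℓ := by
    rw [← h, ← Nat.card_eq_fintype_card]; rfl
  rw [← Ideal.Quotient.eq, map_pow, ← hc]
  exact FiniteField.pow_card _

theorem le_absNorm_of_natCast_mem {ℓ : ℕ} (hℓ : ℓ.Prime) {P : Ideal (𝓞 K)} (hPp : P.IsPrime)
    (hP : (ℓ : 𝓞 K) ∈ P) : ℓ ^ 1 ≤ absNorm P := by
  obtain ⟨j, hj⟩ := exists_absNorm_eq_pow hℓ hPp hP
  rw [hj]
  exact Nat.pow_le_pow_right hℓ.pos (by omega)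

theorem sq_le_absNorm_of_pow_sub_notMem {ℓ : ℕ} (hℓ : ℓ.Prime) {P : Ideal (𝓞 K)} (hPp : P.IsPrime)
    (hP : (ℓ : 𝓞 K) ∈ P) (x : 𝓞 K) (hx : x ^ ℓ - x ∉ P) : ℓ ^ 2 ≤ absNorm P := by
  obtain ⟨j, hj⟩ := exists_absNorm_eq_pow hℓ hPp hP
  rcases j with _ | j
  · exact absurd (pow_sub_mem_of_absNorm_eq
      (hPp.isMaximal (ne_bot_of_natCast_mem hℓ.ne_zero hP)) (by rw [hj, zero_add, pow_one])
      hℓ.ne_zero x) hx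
  · rw [hj]
    exact Nat.pow_le_pow_right hℓ.pos (by omega)

theorem eq_of_natCast_mem_pow {ℓ : ℕ} (hℓ : ℓ.Prime) {a b : ℕ} (ha : a ≠ 0)
    (hab : Module.finrank ℚ K < 2 * (a * b)) {P Q : Ideal (𝓞 K)} (hPp : P.IsPrime) (hQp : Q.IsPrime)
    (hP : (ℓ : 𝓞 K) ∈ P ^ a) (hQ : (ℓ : 𝓞 K) ∈ Q ^ a) (hPb : ℓ ^ b ≤ absNorm P)
    (hQb : ℓ ^ b ≤ absNorm Q) : P = Q := by
  by_contra hne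
  have hPm := hPp.isMaximal (ne_bot_of_natCast_mem hℓ.ne_zero (pow_le_self ha hP))
  have hQm := hQp.isMaximal (ne_bot_of_natCast_mem hℓ.ne_zero (pow_le_self ha hQ))
  have hco : IsCoprime (P ^ a) (Q ^ a) :=
    (Ideal.isCoprime_iff_sup_eq.mpr (hPm.coprime_of_ne hQm hne)).pow
  have hle : span {(ℓ : 𝓞 K)} ≤ P ^ a * Q ^ a := by
    rw [Ideal.mul_eq_inf_of_isCoprime hco, span_singleton_le_iff_mem]
    exact ⟨hP, hQ⟩
  have h := Nat.le_of_dvd (by rw [absNorm_span_natCast]; exact pow_pos hℓ.pos _)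
    (absNorm_dvd_absNorm_of_le hle)
  rw [absNorm_span_natCast, map_mul, map_pow, map_pow, RingOfIntegers.rank] at h
  have h1 : (ℓ ^ b) ^ a * (ℓ ^ b) ^ a ≤ ℓ ^ Module.finrank ℚ K :=
    (Nat.mul_le_mul (Nat.pow_le_pow_left hPb a) (Nat.pow_le_pow_left hQb a)).trans h
  rw [← pow_mul, ← pow_add] at h1
  have := (Nat.pow_le_pow_iff_right hℓ.one_lt).mp h1
  linarith [mul_comm a b]

end Primes

section Quadratic

open Ideal NumberField

variable {K L : Type*} [Field K] [NumberField K] [Field L] [NumberField L] [Algebra K L]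

theorem isTotallyReal_of_isQuadraticExtension [IsTotallyReal K] [Algebra.IsQuadraticExtension K L]
    {r : L} {d : ℕ} (hr : r ^ 2 = d) (hrK : r ∉ Set.range (algebraMap K L)) :
    IsTotallyReal L := by
  obtain ⟨σ, hσr, hσ, hfix⟩ := exists_conj (d := (d : K)) (by rw [hr, map_natCast]) hrK
  have hr0 : r ≠ 0 := by
    rintro rfl
    exact hrK ⟨0, map_zero _⟩
  refine ⟨fun v => ?_⟩
  rw [InfinitePlace.isReal_iff, ComplexEmbedding.isReal_iff]
  set φ := v.embedding
  have hK : ∀ x ∈ Set.range (algebraMap K L), starRingEnd ℂ (φ x) = φ x := by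
    rintro _ ⟨x, rfl⟩
    exact RingHom.congr_fun (ComplexEmbedding.isReal_iff.mp
      (IsTotallyReal.complexEmbedding_isReal (φ.comp (algebraMap K L)))) x
  have hφr : starRingEnd ℂ (φ r) = φ r := by
    have h1 : (φ r) ^ 2 = d := by rw [← map_pow, hr, map_natCast]
    rw [Complex.conj_eq_iff_im]
    have h2 := congrArg Complex.re h1
    have h3 := congrArg Complex.im h1
    simp only [pow_two, Complex.mul_re, Complex.mul_im, Complex.natCast_re,
      Complex.natCast_im] at h2 h3
    have h4 : (φ r).re * (φ r).im = 0 := by linarith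
    rcases mul_eq_zero.mp h4 with h | h
    · rw [h] at h2
      nlinarith [(Nat.cast_nonneg d : (0 : ℝ) ≤ d)]
    · exact h
  ext x
  rw [ComplexEmbedding.conjugate_coe_eq]
  have h1 := hK (x + σ x) (hfix _ (by rw [map_add, hσ, add_comm]))
  have h2 := hK ((x - σ x) * r) (hfix _ (by rw [map_mul, map_sub, hσ, hσr]; ring))
  have h3 : φ x = (φ (x + σ x) + φ ((x - σ x) * r) / φ r) / 2 := by
    have : φ r ≠ 0 := by simpa using hr0
    rw [map_mul, mul_div_cancel_right₀ _ this, ← map_add]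
    rw [show x + σ x + (x - σ x) = 2 * x by ring, map_mul, map_ofNat]
    ring
  rw [h3, map_div₀, map_add, map_div₀, h1, h2, hφr, map_ofNat]

omit [NumberField L] in
theorem mem_range_or_mul_mem_range [Algebra.IsQuadraticExtension K L]
    {r x : L} {d m : K} (hr : r ^ 2 = algebraMap K L d) (hrK : r ∉ Set.range (algebraMap K L))
    (hx : x ^ 2 = algebraMap K L m) :
    x ∈ Set.range (algebraMap K L) ∨ x * r ∈ Set.range (algebraMap K L) := by
  obtain ⟨σ, hσr, hσ, hfix⟩ := exists_conj hr hrK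
  have h : (σ x) ^ 2 = x ^ 2 := by rw [← map_pow, hx, σ.commutes]
  rcases sq_eq_sq_iff_eq_or_eq_neg.mp h with h | h
  · exact Or.inl (hfix x h)
  · exact Or.inr (hfix _ (by rw [map_mul, h, hσr]; ring))

omit [NumberField K] in
open IntermediateField in
theorem isQuadraticExtension_adjoin_simple {E : Type*} [Field E] [Algebra K E] {r : E} {d : K}
    (hr : r ^ 2 = algebraMap K E d) (hrK : r ∉ Set.range (algebraMap K E)) :
    Algebra.IsQuadraticExtension K K⟮r⟯ := by
  have hmonic : (Polynomial.X ^ 2 - Polynomial.C d : Polynomial K).Monic :=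
    Polynomial.monic_X_pow_sub_C d two_ne_zero
  have hroot : Polynomial.aeval r (Polynomial.X ^ 2 - Polynomial.C d : Polynomial K) = 0 := by
    simp [hr]
  have hint : IsIntegral K r := ⟨_, hmonic, hroot⟩
  have h1 : Module.finrank K K⟮r⟯ ≤ 2 := by
    rw [adjoin.finrank hint]
    refine (Polynomial.natDegree_le_of_dvd (minpoly.dvd K r hroot) hmonic.ne_zero).trans ?_
    rw [Polynomial.natDegree_X_pow_sub_C]
  have := adjoin.finiteDimensional hint
  have h2 : 0 < Module.finrank K K⟮r⟯ := Module.finrank_pos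
  have h3 : Module.finrank K K⟮r⟯ ≠ 1 := by
    rw [Ne, finrank_adjoin_simple_eq_one_iff, IntermediateField.mem_bot]
    exact hrK
  exact ⟨by omega⟩

end Quadratic

section Arithmetic

open Ideal NumberField

theorem eq_zero_of_prime_mul_sq_add_sq_eq {q : ℕ} (hq : q.Prime) (hq4 : q % 4 = 3) {s t u v : ℤ}
    (h : (q : ℤ) * (s ^ 2 + t ^ 2) = u ^ 2 + v ^ 2) : s = 0 ∧ t = 0 ∧ u = 0 ∧ v = 0 := by
  have hN : q * (s.natAbs ^ 2 + t.natAbs ^ 2) = u.natAbs ^ 2 + v.natAbs ^ 2 := by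
    zify
    simpa only [sq_abs] using h
  have hN0 : s.natAbs ^ 2 + t.natAbs ^ 2 = 0 := by
    by_contra hne
    have := Fact.mk hq
    have h1 := Nat.eq_sq_add_sq_iff.mp ⟨u.natAbs, v.natAbs, hN⟩ (q := q)
      (by
        rw [Nat.mem_primeFactors]
        exact ⟨hq, dvd_mul_right _ _, mul_ne_zero hq.ne_zero hne⟩) hq4
    rw [padicValNat.mul hq.ne_zero hne, padicValNat_self] at h1
    have h2 : Even (padicValNat q (s.natAbs ^ 2 + t.natAbs ^ 2)) := by
      by_cases hd : q ∣ s.natAbs ^ 2 + t.natAbs ^ 2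
      · exact Nat.eq_sq_add_sq_iff.mp ⟨s.natAbs, t.natAbs, rfl⟩ (q := q)
          (by simp only [Nat.mem_primeFactors]; exact ⟨hq, hd, hne⟩) hq4
      · rw [padicValNat.eq_zero_of_not_dvd hd]; exact Even.zero
    exact absurd ((Nat.even_add.mp h1).mpr h2) (by decide)
  rw [hN0, mul_zero] at hN
  have h1 := (Nat.add_eq_zero_iff.mp hN0)
  have h2 := (Nat.add_eq_zero_iff.mp hN.symm)
  simp only [pow_eq_zero_iff, ne_eq, OfNat.ofNat_ne_zero, not_false_eq_true,
    Int.natAbs_eq_zero] at h1 h2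
  exact ⟨h1.1, h1.2, h2.1, h2.2⟩

end Arithmetic

section Steps

open Ideal NumberField

theorem exists_intCast_eq (a : 𝓞 ℚ) : ∃ n : ℤ, (n : 𝓞 ℚ) = a :=
  ⟨Rat.ringOfIntegersEquiv a, by
    apply Rat.ringOfIntegersEquiv.injective
    rw [map_intCast]; rfl⟩

theorem odd_card_classGroup_rat : Odd (Nat.card (ClassGroup (𝓞 ℚ))) := by
  rw [Nat.card_eq_fintype_card, ← NumberField.classNumber, Rat.classNumber_eq]
  exact odd_one

/-- A square root of a natural number in a field is an algebraic integer. -/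
theorem exists_integer_sq_eq {K : Type*} [Field K] {r : K} {d : ℕ} (hr : r ^ 2 = d) :
    ∃ s : 𝓞 K, (s : K) = r ∧ s ^ 2 = d := by
  have hi : IsIntegral ℤ r := by
    refine IsIntegral.of_pow two_pos ?_
    rw [hr, ← map_natCast (algebraMap ℤ K)]
    exact isIntegral_algebraMap
  exact ⟨⟨r, hi⟩, rfl, RingOfIntegers.ext
    (hr.trans (map_natCast (algebraMap (𝓞 K) K) d).symm)⟩

theorem exists_two_mul_eq_one_add {K : Type*} [Field K] [CharZero K] {p : ℕ} (hp : p % 4 = 1)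
    {r : 𝓞 K} (hr : r ^ 2 = p) : ∃ θ : 𝓞 K, 2 * θ = 1 + r := by
  have hr' : (r : K) ^ 2 = 4 * (p / 4 : ℕ) + 1 := by
    have h1 : (r : K) ^ 2 = p := by simpa using congrArg (algebraMap (𝓞 K) K) hr
    rw [h1]
    exact_mod_cast congrArg (Nat.cast : ℕ → K) (by omega : p = 4 * (p / 4) + 1)
  have hi : IsIntegral ℤ ((1 + r : K) / 2) := by
    refine ⟨Polynomial.X ^ 2 - Polynomial.X - Polynomial.C ((p / 4 : ℕ) : ℤ), ?_, ?_⟩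
    · monicity!
    · rw [Polynomial.eval₂_sub, Polynomial.eval₂_sub, Polynomial.eval₂_X_pow, Polynomial.eval₂_X,
        Polynomial.eval₂_C, map_natCast]
      linear_combination hr' / 4
  refine ⟨⟨_, hi⟩, RingOfIntegers.ext ?_⟩
  change 2 * ((1 + r : K) / 2) = 1 + r
  ring

theorem mem_of_pow_natCast_mem {R : Type*} [CommRing R] {P : Ideal R} (hP : P.IsPrime) {a b : ℕ}
    (h : ((a ^ b : ℕ) : R) ∈ P) : (a : R) ∈ P := by
  rw [Nat.cast_pow] at h
  exact hP.mem_of_pow_mem _ h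

theorem notMem_of_coprime {R : Type*} [CommRing R] {P : Ideal R} (hP : P.IsPrime) {a b : ℕ}
    (hab : a.Coprime b) (ha : (a : R) ∈ P) : (b : R) ∉ P := by
  intro hb
  obtain ⟨x, y, h⟩ := (Nat.isCoprime_iff_coprime.mpr hab)
  apply hP.ne_top
  rw [eq_top_iff_one]
  have : (1 : R) = x * a + y * b := by exact_mod_cast (congrArg (Int.cast : ℤ → R) h).symm
  rw [this]
  exact P.add_mem (P.mul_mem_left _ ha) (P.mul_mem_left _ hb)

theorem odd_card_classGroup_of_three_mod_four {F : Type*} [Field F] [NumberField F]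
    [Algebra ℚ F] [Algebra.IsQuadraticExtension ℚ F] {q : ℕ} (hq : q.Prime) (hq4 : q % 4 = 3)
    {r : F} (hr₀ : r ^ 2 = q) (hrQ : r ∉ Set.range (algebraMap ℚ F)) :
    Odd (Nat.card (ClassGroup (𝓞 F))) := by
  have := isTotallyReal_of_isQuadraticExtension hr₀ hrQ
  obtain ⟨r, rfl, hr⟩ := exists_integer_sq_eq hr₀
  refine odd_card_classGroup_of_isQuadraticExtension odd_card_classGroup_rat r q
    (by rw [hr, map_natCast]) hrQ r (4 * q) (fun σ hσ => ⟨2 * r, ?_⟩)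
    (Or.inr ⟨?_, -1, fun σ hσr hσ hfix x y hy hxy => hy ?_⟩)
  · rw [hσ, map_mul, map_natCast, map_ofNat, ← hr]; ring
  · have key : ∀ ℓ : ℕ, ℓ.Prime →
        {P : Ideal (𝓞 ℚ) | P.IsPrime ∧ (ℓ : 𝓞 ℚ) ∈ P}.encard ≤ 1 := by
      intro ℓ hℓ
      rw [Set.encard_le_one_iff]
      rintro P Q ⟨hP, hPℓ⟩ ⟨hQ, hQℓ⟩
      refine eq_of_natCast_mem_pow hℓ one_ne_zero (b := 1) (by simp) hP hQ (by rwa [pow_one])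
        (by rwa [pow_one]) (le_absNorm_of_natCast_mem hℓ hP hPℓ)
        (le_absNorm_of_natCast_mem hℓ hQ hQℓ)
    calc _ ≤ ({P : Ideal (𝓞 ℚ) | P.IsPrime ∧ ((2 : ℕ) : 𝓞 ℚ) ∈ P} ∪
          {P : Ideal (𝓞 ℚ) | P.IsPrime ∧ (q : 𝓞 ℚ) ∈ P}).encard := by
          refine Set.encard_le_encard ?_
          rintro P ⟨hP, h⟩
          rcases hP.mem_or_mem h with h | h
          · exact Or.inl ⟨hP, mem_of_pow_natCast_mem hP (a := 2) (b := 2) (by norm_num; exact h)⟩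
          · exact Or.inr ⟨hP, h⟩
      _ ≤ 1 + 1 := (Set.encard_union_le _ _).trans (add_le_add (key 2 Nat.prime_two) (key q hq))
      _ = 2 := one_add_one_eq_two
  · have hint : ∀ z, σ z = z → ∃ n : ℤ, (n : 𝓞 F) = z := by
      intro z hz
      obtain ⟨a, rfl⟩ := hfix z hz
      obtain ⟨n, rfl⟩ := exists_intCast_eq a
      exact ⟨n, (map_intCast _ n).symm⟩
    have hadd : ∀ z, ∃ n : ℤ, (n : 𝓞 F) = z + σ z := fun z =>
      hint _ (by rw [map_add, hσ, add_comm])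
    have hsub : ∀ z, ∃ n : ℤ, (n : 𝓞 F) = (z - σ z) * r := fun z =>
      hint _ (by rw [map_mul, map_sub, hσ, hσr]; ring)
    obtain ⟨s, hs⟩ := hadd x
    obtain ⟨s', hs'⟩ := hadd y
    obtain ⟨t, ht⟩ := hsub x
    obtain ⟨t', ht'⟩ := hsub y
    have h : (q : ℤ) * (s ^ 2 + s' ^ 2) = t ^ 2 + t' ^ 2 := by
      have : ((q * (s ^ 2 + s' ^ 2) : ℤ) : 𝓞 F) = ((t ^ 2 + t' ^ 2 : ℤ) : 𝓞 F) := by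
        push_cast
        rw [hs, hs', ht, ht', ← hr]
        simp only [Units.val_neg, Units.val_one, map_neg, map_one] at hxy
        linear_combination 4 * r ^ 2 * hxy
      exact_mod_cast this
    obtain ⟨-, h1, -, h2⟩ := eq_zero_of_prime_mul_sq_add_sq_eq hq hq4 h
    have hr0 : r ≠ 0 := by
      rintro rfl
      exact hrQ ⟨0, by simp⟩
    rw [h1, Int.cast_zero] at hs'
    rw [h2, Int.cast_zero] at ht'
    have h3 := (mul_eq_zero.mp ht'.symm).resolve_right hr0
    have h4 : 2 * y = 0 := by linear_combination h3 - hs'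
    exact (mul_eq_zero.mp h4).resolve_left two_ne_zero

theorem odd_card_classGroup_of_inert {F k : Type*} [Field F] [NumberField F] [IsTotallyReal F]
    [Field k] [NumberField k] [Algebra F k] [Algebra.IsQuadraticExtension F k]
    (hF : Odd (Nat.card (ClassGroup (𝓞 F)))) (hF2 : Module.finrank ℚ F = 2)
    {p q : ℕ} [Fact p.Prime] (hp4 : p % 4 = 1) (hpq : legendreSym p q = -1) {a : F}
    (ha₀ : a ^ 2 = q) {r : k} (hr₀ : r ^ 2 = p) (hrF : r ∉ Set.range (algebraMap F k)) :
    Odd (Nat.card (ClassGroup (𝓞 k))) := by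
  have hp : p.Prime := Fact.out
  have := isTotallyReal_of_isQuadraticExtension hr₀ hrF
  obtain ⟨r, rfl, hr⟩ := exists_integer_sq_eq hr₀
  obtain ⟨a, rfl, ha⟩ := exists_integer_sq_eq ha₀
  obtain ⟨θ, hθ⟩ := exists_two_mul_eq_one_add hp4 hr
  refine odd_card_classGroup_of_isQuadraticExtension hF r p (by rw [hr, map_natCast]) hrF θ p
    (fun σ hσ => ⟨r, ?_⟩) (Or.inl ?_)
  · have h : 2 * σ θ = 1 - r := by
      have := congrArg σ hθ
      rw [map_mul, map_ofNat, map_add, map_one, hσ] at this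
      rw [this]; ring
    have h2 : 2 * (θ - σ θ) = 2 * r := by linear_combination hθ - h
    rw [mul_left_cancel₀ two_ne_zero h2, map_natCast, ← hr, pow_two]
  · have key : ∀ P : Ideal (𝓞 F), P.IsPrime → (p : 𝓞 F) ∈ P → p ^ 2 ≤ absNorm P := by
      intro P hP hPp
      refine sq_le_absNorm_of_pow_sub_notMem hp hP hPp a fun h => ?_
      obtain ⟨c, hc⟩ : (p : ℤ) ∣ (q : ℤ) ^ (p / 2) + 1 := by
        rw [← ZMod.intCast_zmod_eq_zero_iff_dvd]
        have := legendreSym.eq_pow p (q : ℤ)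
        rw [hpq] at this
        push_cast at this ⊢
        rw [← this]; ring
      have hc' : (q : 𝓞 F) ^ (p / 2) + 1 = p * c := by
        exact_mod_cast congrArg (Int.cast : ℤ → 𝓞 F) hc
      have h1 : a ^ p = a * (q : 𝓞 F) ^ (p / 2) := by
        rw [← ha, ← pow_mul, ← pow_succ']
        congr 1; omega
      have h2 : a * 2 ∈ P := by
        have : a * 2 = a * c * p - (a ^ p - a) := by
          rw [h1]; linear_combination a * hc'
        rw [this]
        exact P.sub_mem (P.mul_mem_left _ hPp) h
      have hqp : p.Coprime q := by
        rw [Nat.Prime.coprime_iff_not_dvd hp]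
        intro hd
        rw [(legendreSym.eq_zero_iff p q).mpr] at hpq
        · norm_num at hpq
        · exact_mod_cast (ZMod.natCast_eq_zero_iff q p).mpr hd
      rcases hP.mem_or_mem h2 with h3 | h3
      · refine notMem_of_coprime hP hqp hPp ?_
        rw [← ha, pow_two]
        exact P.mul_mem_left _ h3
      · refine notMem_of_coprime hP (b := 2) ?_ hPp (by exact_mod_cast h3)
        rw [Nat.coprime_two_right, Nat.odd_iff]; omega
    rw [Set.encard_le_one_iff]
    rintro P Q ⟨hP, hPp⟩ ⟨hQ, hQp⟩
    exact eq_of_natCast_mem_pow hp one_ne_zero (b := 2) (by rw [hF2]; norm_num) hP hQ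
      (by rwa [pow_one]) (by rwa [pow_one]) (key P hP hPp) (key Q hQ hQp)

theorem odd_card_classGroup_adjoin_sqrt_two {k L : Type*} [Field k] [NumberField k]
    [IsTotallyReal k] [Field L] [NumberField L] [Algebra k L] [Algebra.IsQuadraticExtension k L]
    (hk : Odd (Nat.card (ClassGroup (𝓞 k)))) (hk4 : Module.finrank ℚ k = 4)
    {p q : ℕ} (hp8 : p % 8 = 5) (hq4 : q % 4 = 3) {a b : k} (ha₀ : a ^ 2 = q) (hb₀ : b ^ 2 = p)
    {r : L} (hr₀ : r ^ 2 = (2 : ℕ)) (hrk : r ∉ Set.range (algebraMap k L)) :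
    Odd (Nat.card (ClassGroup (𝓞 L))) := by
  have := isTotallyReal_of_isQuadraticExtension hr₀ hrk
  obtain ⟨r, rfl, hr⟩ := exists_integer_sq_eq hr₀
  obtain ⟨a, rfl, ha⟩ := exists_integer_sq_eq ha₀
  obtain ⟨b, rfl, hb⟩ := exists_integer_sq_eq hb₀
  obtain ⟨ω, hω⟩ := exists_two_mul_eq_one_add (by omega : p % 4 = 1) hb
  refine odd_card_classGroup_of_isQuadraticExtension hk r (2 : ℕ) (by rw [hr, map_natCast]) hrk r
    (2 ^ 3 : ℕ) (fun σ hσ => ⟨2 * r, ?_⟩) (Or.inl ?_)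
  · rw [hσ, map_natCast]
    push_cast at hr ⊢
    linear_combination -4 * hr
  · have h2mem : ∀ P : Ideal (𝓞 k), P.IsPrime → ((2 : ℕ) : 𝓞 k) ∈ P →
        ((2 : ℕ) : 𝓞 k) ∈ P ^ 2 := by
      intro P hP h2
      push_cast at h2 ⊢
      obtain ⟨j, hj⟩ : ∃ j, q = 4 * j + 3 := ⟨q / 4, by omega⟩
      have ha' : a ^ 2 = 4 * j + 3 := by rw [ha, hj]; push_cast; ring
      have h4 : (4 : 𝓞 k) ∈ P ^ 2 := by
        rw [show (4 : 𝓞 k) = 2 ^ 2 by norm_num]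
        exact pow_mem_pow h2 2
      have h1 : 1 + a ∈ P := by
        refine hP.mem_of_pow_mem 2 ?_
        rw [show (1 + a) ^ 2 = (2 * j + 2 + a) * 2 by linear_combination ha']
        exact P.mul_mem_left _ h2
      have h3 : 2 * a ∈ P ^ 2 := by
        rw [show 2 * a = (1 + a) ^ 2 - (j + 1) * 4 by linear_combination -ha']
        exact (P ^ 2).sub_mem (pow_mem_pow h1 2) ((P ^ 2).mul_mem_left _ h4)
      rw [show (2 : 𝓞 k) = a * (2 * a) - (2 * j + 1) * 4 by linear_combination -2 * ha']
      exact (P ^ 2).sub_mem ((P ^ 2).mul_mem_left _ h3) ((P ^ 2).mul_mem_left _ h4)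
    have key : ∀ P : Ideal (𝓞 k), P.IsPrime → ((2 : ℕ) : 𝓞 k) ∈ P → 2 ^ 2 ≤ absNorm P := by
      intro P hP h2
      refine sq_le_absNorm_of_pow_sub_notMem Nat.prime_two hP h2 ω fun h => ?_
      have h1 : ω ^ 2 - ω = ((p / 4 : ℕ) : 𝓞 k) := by
        have h3 : (p : 𝓞 k) = 4 * ((p / 4 : ℕ) : 𝓞 k) + 1 := by
          exact_mod_cast congrArg (Nat.cast : ℕ → 𝓞 k) (by omega : p = 4 * (p / 4) + 1)
        apply mul_left_cancel₀ (by norm_num : (4 : 𝓞 k) ≠ 0)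
        rw [h3] at hb
        linear_combination hb + (2 * ω - 1 + b) * hω
      rw [h1] at h
      refine notMem_of_coprime hP ?_ h2 h
      rw [Nat.coprime_two_left, Nat.odd_iff]; omega
    rw [Set.encard_le_one_iff]
    rintro P Q ⟨hP, hP8⟩ ⟨hQ, hQ8⟩
    have hP2 := mem_of_pow_natCast_mem hP hP8
    have hQ2 := mem_of_pow_natCast_mem hQ hQ8
    exact eq_of_natCast_mem_pow Nat.prime_two two_ne_zero (b := 2) (by rw [hk4]; norm_num) hP hQ
      (h2mem P hP hP2) (h2mem Q hQ hQ2) (key P hP hP2) (key Q hQ hQ2)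

end Steps

section Tower

open NumberField IntermediateField

theorem sqrt_notMem_range_rat {n : ℕ} (hn : ¬ IsSquare n) :
    √(n : ℝ) ∉ Set.range (algebraMap ℚ ℝ) := by
  have h := irrational_sqrt_natCast_iff.mpr hn
  rwa [Irrational] at h

theorem isQuadraticExtension_adjoin_sqrt {K : Type*} [Field K] [NumberField K] [Algebra K ℝ]
    {n : ℕ} (hn : √(n : ℝ) ∉ Set.range (algebraMap K ℝ)) :
    Algebra.IsQuadraticExtension K K⟮√(n : ℝ)⟯ :=
  isQuadraticExtension_adjoin_simple (d := (n : K)) (by simp) hn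

theorem gen_sqrt_sq {K : Type*} [Field K] [Algebra K ℝ] (n : ℕ) :
    AdjoinSimple.gen K √(n : ℝ) ^ 2 = n :=
  Subtype.ext (by simp)

theorem gen_sqrt_notMem_range {K : Type*} [Field K] [Algebra K ℝ] {n : ℕ}
    (hn : √(n : ℝ) ∉ Set.range (algebraMap K ℝ)) :
    AdjoinSimple.gen K √(n : ℝ) ∉ Set.range (algebraMap K K⟮√(n : ℝ)⟯) := by
  rintro ⟨y, hy⟩
  exact hn ⟨y, congrArg (algebraMap K⟮√(n : ℝ)⟯ ℝ) hy⟩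

theorem finrank_rat_of_isQuadraticExtension (K L : Type*) [Field K] [NumberField K] [Field L]
    [NumberField L] [Algebra K L] [Algebra.IsQuadraticExtension K L] :
    Module.finrank ℚ L = Module.finrank ℚ K * 2 := by
  rw [← Module.finrank_mul_finrank ℚ K L,
    Algebra.IsQuadraticExtension.finrank_eq_two K L]

/-- If neither `√n` nor `√(n * d)` lies in `K`, then `√n` does not lie in `K(√d)`. -/
theorem sqrt_notMem_range_adjoin {K : Type*} [Field K] [NumberField K] [Algebra K ℝ] {n d : ℕ}
    (hd : √(d : ℝ) ∉ Set.range (algebraMap K ℝ)) (hn : √(n : ℝ) ∉ Set.range (algebraMap K ℝ))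
    (hnd : √((n * d : ℕ) : ℝ) ∉ Set.range (algebraMap K ℝ)) :
    √(n : ℝ) ∉ Set.range (algebraMap K⟮√(d : ℝ)⟯ ℝ) := by
  have := isQuadraticExtension_adjoin_sqrt hd
  rintro ⟨x, hx⟩
  let r := AdjoinSimple.gen K √(d : ℝ)
  have hr : r ^ 2 = algebraMap K _ (d : K) := by rw [map_natCast]; exact gen_sqrt_sq d
  have hrK := gen_sqrt_notMem_range hd
  have hx2 : x ^ 2 = algebraMap K _ (n : K) :=
    Subtype.ext (by change (x : ℝ) ^ 2 = _; rw [show (x : ℝ) = √(n : ℝ) from hx]; simp)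
  rcases mem_range_or_mul_mem_range hr hrK hx2 with ⟨y, hy⟩ | ⟨y, hy⟩
  · exact hn ⟨y, (congrArg (algebraMap K⟮√(d : ℝ)⟯ ℝ) hy).trans hx⟩
  · refine hnd ⟨y, (congrArg (algebraMap K⟮√(d : ℝ)⟯ ℝ) hy).trans ?_⟩
    rw [map_mul, hx, Nat.cast_mul, Real.sqrt_mul (Nat.cast_nonneg n)]
    rfl

theorem not_isSquare_of_mod_eight {n : ℕ} (h : n % 8 ≠ 0 ∧ n % 8 ≠ 1 ∧ n % 8 ≠ 4) :
    ¬ IsSquare n := by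
  rintro ⟨m, rfl⟩
  have : m % 8 < 8 := Nat.mod_lt _ (by norm_num)
  rw [Nat.mul_mod] at h
  generalize m % 8 = k at *
  interval_cases k <;> simp at h

theorem numberField_of_isQuadraticExtension (K L : Type*) [Field K] [NumberField K] [Field L]
    [CharZero L] [Algebra K L] [Algebra.IsQuadraticExtension K L] : NumberField L :=
  NumberField.of_module_finite K L

theorem coe_adjoin_adjoin_adjoin_simple (K : Type*) {E : Type*} [Field K] [Field E] [Algebra K E]
    (x y z : E) : (K⟮x⟯⟮y⟯⟮z⟯ : Set E) = adjoin K {z, y, x} := by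
  have h : (K⟮x⟯⟮y⟯⟮z⟯ : Set E) = adjoin K⟮x⟯ {y, z} :=
    congrArg (fun S : IntermediateField K⟮x⟯ E => (S : Set E))
      (adjoin_simple_adjoin_simple K⟮x⟯ y z)
  have h' : (adjoin K⟮x⟯ {y, z} : Set E) = adjoin K ({x} ∪ {y, z}) :=
    congrArg (fun S : IntermediateField K E => (S : Set E)) (adjoin_adjoin_left K {x} {y, z})
  rw [h, h']
  congr 2
  ext
  simp
  tauto

theorem odd_card_classGroup_tower (p q : ℕ) [Fact (Nat.Prime p)] [Fact (Nat.Prime q)]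
    (hp : p % 8 = 5) (hq : q % 8 = 3) (hleg : legendreSym q (p : ℤ) = -1) :
    Odd (Nat.card (ClassGroup (𝓞 ℚ⟮√(q : ℝ)⟯⟮√(p : ℝ)⟯⟮√((2 : ℕ) : ℝ)⟯))) := by
  have hrat : ∀ n : ℕ, n % 8 ≠ 0 ∧ n % 8 ≠ 1 ∧ n % 8 ≠ 4 →
    √(n : ℝ) ∉ Set.range (algebraMap ℚ ℝ) := fun n hn =>
      sqrt_notMem_range_rat (not_isSquare_of_mod_eight hn)
  have hqQ := hrat q (by omega)
  have hquadF : Algebra.IsQuadraticExtension ℚ ℚ⟮√(q : ℝ)⟯ := by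
    convert isQuadraticExtension_adjoin_sqrt hqQ
    · rfl
    · exact Subsingleton.elim _ _
  have haQ : AdjoinSimple.gen ℚ √(q : ℝ) ∉ Set.range (algebraMap ℚ ℚ⟮√(q : ℝ)⟯) := by
    convert gen_sqrt_notMem_range hqQ
    · rfl
    · exact Subsingleton.elim _ _
  have := numberField_of_isQuadraticExtension ℚ ℚ⟮√(q : ℝ)⟯
  have hF : ∀ n : ℕ, n % 8 ≠ 0 ∧ n % 8 ≠ 1 ∧ n % 8 ≠ 4 ∧ n % 8 ≠ 3 →
      √(n : ℝ) ∉ Set.range (algebraMap ℚ⟮√(q : ℝ)⟯ ℝ) := by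
    intro n hn
    refine sqrt_notMem_range_adjoin hqQ (hrat n (by omega)) (hrat _ ?_)
    rw [Nat.mul_mod, hq]
    omega
  have hpF := hF p (by omega)
  have := isQuadraticExtension_adjoin_sqrt hpF
  have := numberField_of_isQuadraticExtension ℚ⟮√(q : ℝ)⟯ ℚ⟮√(q : ℝ)⟯⟮√(p : ℝ)⟯
  have h2k : √((2 : ℕ) : ℝ) ∉ Set.range (algebraMap ℚ⟮√(q : ℝ)⟯⟮√(p : ℝ)⟯ ℝ) :=
    sqrt_notMem_range_adjoin hpF (hF 2 (by omega)) (hF _ (by omega))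
  have := isQuadraticExtension_adjoin_sqrt h2k
  have := numberField_of_isQuadraticExtension ℚ⟮√(q : ℝ)⟯⟮√(p : ℝ)⟯
    ℚ⟮√(q : ℝ)⟯⟮√(p : ℝ)⟯⟮√((2 : ℕ) : ℝ)⟯
  have := isTotallyReal_of_isQuadraticExtension (gen_sqrt_sq q) haQ
  have := isTotallyReal_of_isQuadraticExtension (gen_sqrt_sq p) (gen_sqrt_notMem_range hpF)
  have hF2 : Module.finrank ℚ ℚ⟮√(q : ℝ)⟯ = 2 := hquadF.finrank_eq_two
  have hk4 := finrank_rat_of_isQuadraticExtension ℚ⟮√(q : ℝ)⟯ ℚ⟮√(q : ℝ)⟯⟮√(p : ℝ)⟯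
  rw [hF2] at hk4
  have hpq : legendreSym p q = -1 := by
    rw [← legendreSym.quadratic_reciprocity_one_mod_four (p := p) (q := q) (by omega) (by omega)]
    exact hleg
  have h1 := odd_card_classGroup_of_three_mod_four Fact.out (by omega) (gen_sqrt_sq q)
    haQ
  have h2 := odd_card_classGroup_of_inert h1 hF2 (by omega) hpq (gen_sqrt_sq q) (gen_sqrt_sq p)
    (gen_sqrt_notMem_range hpF)
  have ha : algebraMap _ ℚ⟮√(q : ℝ)⟯⟮√(p : ℝ)⟯ (AdjoinSimple.gen ℚ √(q : ℝ)) ^ 2 = (q : _) := by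
    rw [← map_pow, gen_sqrt_sq, map_natCast]
  exact odd_card_classGroup_adjoin_sqrt_two h2 hk4 hp (by omega) ha (gen_sqrt_sq p)
    (gen_sqrt_sq 2) (gen_sqrt_notMem_range h2k)

theorem card_classGroup_eq_of_toSubfield_eq {E : Type*} [Field E] {S T : Subfield E} (h : S = T) :
    Nat.card (ClassGroup (𝓞 S)) = Nat.card (ClassGroup (𝓞 T)) := by
  rw [h]

end Tower

end QuadraticGenus

theorem odd_classNumber_Qsqrt2_sqrtp_sqrtq_legendre_neg_one
    (p q : ℕ) [Fact (Nat.Prime p)] [Fact (Nat.Prime q)]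
    (hp : p % 8 = 5) (hq : q % 8 = 3) (hleg : legendreSym q (p : ℤ) = -1) :
    Odd (Nat.card (ClassGroup (integralClosure ℤ
      (IntermediateField.adjoin ℚ
        {Real.sqrt 2, Real.sqrt p, Real.sqrt q} : IntermediateField ℚ ℝ)))) ∧
    2 ^ ((Nat.card (ClassGroup (integralClosure ℤ
      (IntermediateField.adjoin ℚ
        {Real.sqrt 2, Real.sqrt p, Real.sqrt q} : IntermediateField ℚ ℝ)))).factorization 2)
      = 1 := by
  have hodd : Odd (Nat.card (ClassGroup (integralClosure ℤ
      (IntermediateField.adjoin ℚ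
        {Real.sqrt 2, Real.sqrt p, Real.sqrt q} : IntermediateField ℚ ℝ)))) := by
    have h := QuadraticGenus.odd_card_classGroup_tower p q hp hq hleg
    have hS := QuadraticGenus.coe_adjoin_adjoin_adjoin_simple ℚ √(q : ℝ) √(p : ℝ) √((2 : ℕ) : ℝ)
    rw [Nat.cast_ofNat] at hS
    exact (QuadraticGenus.card_classGroup_eq_of_toSubfield_eq
      (SetLike.coe_injective (A := Subfield ℝ) hS)) ▸ h
  refine ⟨hodd, ?_⟩
  rw [Nat.factorization_eq_zero_of_not_dvd hodd.not_two_dvd_nat, pow_zero]
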